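/- arXiv:0910.3569 — 2 statements merged into one kernel-verified Lean document; each statement's English description precedes it below -/
import Mathlib

section
/- Let k be an algebraically closed field of characteristic zero and let d ≥ 3 be an integer that is either odd or ≡ 6 (mod 8). Then: (i) d divides C(d+3,4); set c = C(d+3,4)/d, b = ⌊C(d+4,4)/(d+1)⌋ − c − 2 and b* = ⌈C(d+4,4)/(d+1)⌉ − c − 2; then b > 0; (ii) with x = C(d+1,3) − b(d−1), one has 0 ≤ x < c; (iii) there exist in P^3 a sundial with ideal I(L_1) ∩ I(L_2) ∩ I(P)^2 (where L_1 ≠ L_2 are lines meeting in the point P), lines M_1,…,M_{max(b,b*)}, and points P_1,…,P_c such that, writing I_W (respectively I_{W*}) for the intersection of the sundial ideal, the ideals of M_1,…,M_b (respectively M_1,…,M_{b*}) and the ideals of the c points, one has dim (I_W)_d = C(d+3,3) − (2d+2) − b(d+1) − c and dim (I_{W*})_d = 0. -/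
open MvPolynomial

noncomputable def vanIdeal (k : Type) [Field k] (N : ℕ) (V : Set (Fin N → k)) :
    Ideal (MvPolynomial (Fin N) k) where
  carrier := {f | ∀ v ∈ V, MvPolynomial.eval v f = 0}
  add_mem' := by
    intro f g hf hg v hv
    simp only [Set.mem_setOf_eq] at *
    simp [map_add, hf v hv, hg v hv]
  zero_mem' := by
    intro v hv
    simp
  smul_mem' := by
    intro c f hf v hv
    simp only [Set.mem_setOf_eq] at *
    simp [smul_eq_mul, hf v hv]

noncomputable def hdim (k : Type) [Field k] (N : ℕ)
    (I : Ideal (MvPolynomial (Fin N) k)) (d : ℕ) : ℕ :=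
  Module.finrank k
    ↥(Submodule.restrictScalars k
        (I : Submodule (MvPolynomial (Fin N) k) (MvPolynomial (Fin N) k))
      ⊓ MvPolynomial.homogeneousSubmodule (Fin N) k d)


section LinAlg

variable {k : Type} [Field k]

/-- A finite linearly independent family of functionals has a dual family of vectors. -/
lemma exists_dual_family {V : Type} [AddCommGroup V] [Module k V] [FiniteDimensional k V]
    {ι : Type} [DecidableEq ι] (φ : ι → Module.Dual k V) (h : LinearIndependent k φ) :
    ∃ f : ι → V, ∀ i j, φ i (f j) = if i = j then 1 else 0 := by
  have hinj : LinearMap.ker (Finsupp.linearCombination k φ) = ⊥ :=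
    LinearMap.ker_eq_bot.2 h
  obtain ⟨g, hg⟩ := LinearMap.exists_leftInverse_of_injective _ hinj
  refine ⟨fun j => (Module.evalEquiv k V).symm ((Finsupp.lapply j).comp g), fun i j => ?_⟩
  rw [Module.apply_evalEquiv_symm_apply]
  have := congrArg (fun F => F (Finsupp.single i 1)) hg
  simp at this
  simp [this, Finsupp.single_apply]

lemma li_of_det {V : Type} [AddCommGroup V] [Module k V]
    {ι : Type} [Fintype ι] [DecidableEq ι] (φ : ι → Module.Dual k V) (f : ι → V)
    (h : (Matrix.of fun i j => φ i (f j)).det ≠ 0) : LinearIndependent k φ := by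
  rw [Fintype.linearIndependent_iff]
  intro g hg
  have : Matrix.vecMul g (Matrix.of fun i j => φ i (f j)) = 0 := by
    ext j
    have := congrArg (fun F => F (f j)) hg
    simpa [Matrix.vecMul, dotProduct] using this
  exact fun i => congrFun (Matrix.eq_zero_of_vecMul_eq_zero h this) i

lemma li_of_dual {V : Type} [AddCommGroup V] [Module k V]
    {ι : Type} [DecidableEq ι] (φ : ι → Module.Dual k V) (f : ι → V)
    (h0 : ∀ i, φ i (f i) ≠ 0)
    (h : ∀ i j, i ≠ j → φ i (f j) = 0) : LinearIndependent k φ := by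
  rw [linearIndependent_iff']
  intro s g hg i hi
  have := congrArg (fun F => F (f i)) hg
  simp only [LinearMap.sum_apply, LinearMap.smul_apply, LinearMap.zero_apply] at this
  rw [Finset.sum_eq_single i] at this
  · simpa [h0 i] using this
  · intro j _ hj
    simp [h j i hj]
  · intro h'; exact absurd hi h'

/-- Block triangular criterion for independence of functionals. -/
lemma li_triangular {V U : Type} [AddCommGroup V] [Module k V] [AddCommGroup U] [Module k U]
    {ι κ : Type} (φ : ι → Module.Dual k V) (ψ : κ → Module.Dual k V)
    (χ : κ → Module.Dual k U) (g : U →ₗ[k] V) (c : κ → k) (hc : ∀ i, c i ≠ 0)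
    (hφ : LinearIndependent k φ) (hχ : LinearIndependent k χ)
    (h0 : ∀ i u, φ i (g u) = 0) (h1 : ∀ i u, ψ i (g u) = c i * χ i u) :
    LinearIndependent k (Sum.elim φ ψ) := by
  have hψg : LinearIndependent k (fun i => (ψ i).comp g) := by
    have : (fun i => (ψ i).comp g) = fun i => (Units.mk0 (c i) (hc i)) • χ i := by
      ext i u
      simp [h1, Units.smul_def]
    rw [this]
    exact hχ.units_smul _
  have hψ : LinearIndependent k ψ :=
    LinearIndependent.of_comp (LinearMap.lcomp k k g) hψg
  refine LinearIndependent.sum_type hφ hψ ?_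
  rw [Submodule.disjoint_def]
  intro x hx hx'
  have hz : LinearMap.lcomp k k g x = 0 := by
    have : Submodule.span k (Set.range φ) ≤ LinearMap.ker (LinearMap.lcomp k k g) := by
      rw [Submodule.span_le]
      rintro _ ⟨i, rfl⟩
      simp only [SetLike.mem_coe, LinearMap.mem_ker]
      ext u
      simp [h0]
    exact this hx
  obtain ⟨l, rfl⟩ := (Finsupp.mem_span_range_iff_exists_finsupp).1 hx'
  have : Finsupp.linearCombination k (fun i => (ψ i).comp g) l = 0 := by
    rw [← hz]
    simp [Finsupp.linearCombination_apply, Finsupp.sum, map_sum]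
    rfl
  have hl := (linearIndependent_iff.1 hψg) l this
  simp [hl]

/-- Functionals of a separating family can be chosen to cut down two nested subspaces. -/
lemma cut_down {V : Type} [AddCommGroup V] [Module k V] [FiniteDimensional k V]
    {X : Type} (e : X → Module.Dual k V) (he : ∀ v, (∀ x, e x v = 0) → v = 0)
    (m : ℕ) : ∀ (W₁ W₂ : Submodule k V), W₁ ≤ W₂ → m ≤ Module.finrank k W₂ →
    ∃ p : Fin m → X,
      Module.finrank k ↥(W₁ ⊓ ⨅ i, LinearMap.ker (e (p i))) = Module.finrank k W₁ - m ∧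
      Module.finrank k ↥(W₂ ⊓ ⨅ i, LinearMap.ker (e (p i))) + m = Module.finrank k W₂ := by
  have step : ∀ (W : Submodule k V) (x : X) (w : V), w ∈ W → e x w ≠ 0 →
      Module.finrank k ↥(W ⊓ LinearMap.ker (e x)) + 1 = Module.finrank k W := by
    intro W x w hw hx
    have h1 := LinearMap.finrank_range_add_finrank_ker ((e x).comp W.subtype)
    have h2 : LinearMap.range ((e x).comp W.subtype) = ⊤ := by
      rw [LinearMap.range_eq_top]
      apply LinearMap.surjective
      intro h
      exact hx (congrArg (fun F => F ⟨w, hw⟩) h)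
    rw [h2, finrank_top, Module.finrank_self] at h1
    have h3 : Module.finrank k (LinearMap.ker ((e x).comp W.subtype))
        = Module.finrank k ↥(W ⊓ LinearMap.ker (e x)) := by
      rw [LinearMap.ker_comp, ← Submodule.map_comap_subtype W (LinearMap.ker (e x))]
      exact (LinearEquiv.finrank_eq (Submodule.equivMapOfInjective _ W.injective_subtype _))
    omega
  induction m with
  | zero =>
    intro W₁ W₂ _ _
    refine ⟨Fin.elim0, ?_, ?_⟩
    · rw [iInf_of_empty, inf_top_eq, Nat.sub_zero]
    · rw [iInf_of_empty, inf_top_eq, Nat.add_zero]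
  | succ m ih =>
    intro W₁ W₂ h12 hm
    have key : ∃ x : X,
        Module.finrank k ↥(W₁ ⊓ LinearMap.ker (e x)) = Module.finrank k W₁ - 1 ∧
        Module.finrank k ↥(W₂ ⊓ LinearMap.ker (e x)) + 1 = Module.finrank k W₂ := by
      by_cases hW : W₁ = ⊥
      · have hW2 : W₂ ≠ ⊥ := by
          rintro rfl
          simp at hm
        obtain ⟨w, hw, hw0⟩ := (Submodule.ne_bot_iff _).1 hW2
        obtain ⟨x, hx⟩ : ∃ x, e x w ≠ 0 := by
          by_contra! hcon
          exact hw0 (he w hcon)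
        refine ⟨x, ?_, step W₂ x w hw hx⟩
        subst hW
        simp
      · obtain ⟨w, hw, hw0⟩ := (Submodule.ne_bot_iff _).1 hW
        obtain ⟨x, hx⟩ : ∃ x, e x w ≠ 0 := by
          by_contra! hcon
          exact hw0 (he w hcon)
        refine ⟨x, ?_, step W₂ x w (h12 hw) hx⟩
        have := step W₁ x w hw hx
        omega
    obtain ⟨x, hx1, hx2⟩ := key
    obtain ⟨p, hp1, hp2⟩ := ih (W₁ ⊓ LinearMap.ker (e x)) (W₂ ⊓ LinearMap.ker (e x))
      (inf_le_inf_right _ h12) (by omega)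
    have hinf : (⨅ i, LinearMap.ker (e ((Fin.cons x p : Fin (m+1) → X) i))) =
        LinearMap.ker (e x) ⊓ ⨅ i, LinearMap.ker (e (p i)) := by
      ext v
      simp only [Submodule.mem_iInf, Submodule.mem_inf, Fin.forall_fin_succ, Fin.cons_zero,
        Fin.cons_succ]
    refine ⟨Fin.cons x p, ?_, ?_⟩
    · rw [hinf, ← inf_assoc, hp1, hx1]; omega
    · rw [hinf, ← inf_assoc]; omega

/-- The common kernel of independent functionals has the expected dimension. -/
lemma finrank_common_ker {V : Type} [AddCommGroup V] [Module k V] [FiniteDimensional k V]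
    {ι : Type} [Fintype ι] (φ : ι → Module.Dual k V) (h : LinearIndependent k φ) :
    Module.finrank k ↥(⨅ i, LinearMap.ker (φ i)) + Fintype.card ι = Module.finrank k V := by
  classical
  obtain ⟨f, hf⟩ := exists_dual_family φ h
  have h1 := LinearMap.finrank_range_add_finrank_ker (LinearMap.pi φ)
  have h2 : LinearMap.range (LinearMap.pi φ) = ⊤ := by
    rw [LinearMap.range_eq_top]
    intro y
    refine ⟨∑ j, y j • f j, ?_⟩
    ext i
    simp [hf]
  rw [h2, finrank_top, Module.finrank_fintype_fun_eq_card, LinearMap.ker_pi] at h1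
  omega

end LinAlg

section Evaluation

variable {k : Type} [Field k]

/-- Forms of degree `e` in `n` variables. -/
abbrev Forms (k : Type) [Field k] (n e : ℕ) : Submodule k (MvPolynomial (Fin n) k) :=
  MvPolynomial.homogeneousSubmodule (Fin n) k e

instance formsFinite (n e : ℕ) : FiniteDimensional k (Forms k n e) :=
  Module.Finite.iff_fg.2 (MvPolynomial.homogeneousSubmodule_fg _ _ e)

/-- Evaluation of forms at a vector. -/
noncomputable def evH {n : ℕ} (e : ℕ) (p : Fin n → k) : Module.Dual k (Forms k n e) :=
  (MvPolynomial.aeval p).toLinearMap.comp (Submodule.subtype _)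

lemma evH_apply {n e : ℕ} (p : Fin n → k) (f : Forms k n e) :
    evH e p f = MvPolynomial.eval p f.1 := by
  simp [evH, MvPolynomial.aeval_eq_eval]

/-- Coefficient functional. -/
noncomputable def coH {n : ℕ} (e : ℕ) (m : Fin n →₀ ℕ) : Module.Dual k (Forms k n e) :=
  (MvPolynomial.lcoeff k m).comp (Submodule.subtype _)

lemma coH_apply {n e : ℕ} (m : Fin n →₀ ℕ) (f : Forms k n e) :
    coH e m f = MvPolynomial.coeff m f.1 := by
  simp [coH]

lemma li_coH {n e : ℕ} {ι : Type} (m : ι → (Fin n →₀ ℕ)) (hm : Function.Injective m)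
    (hdeg : ∀ i, (m i).degree = e) : LinearIndependent k (fun i => coH (k := k) e (m i)) := by
  classical
  refine li_of_dual _
    (fun i => ⟨MvPolynomial.monomial (m i) 1, MvPolynomial.isHomogeneous_monomial _ (hdeg i)⟩)
    ?_ ?_
  · intro i
    simp [coH_apply]
  · intro i j hij
    rw [coH_apply, MvPolynomial.coeff_monomial, if_neg]
    exact fun h => hij (hm h).symm

lemma finrank_forms (n e : ℕ) :
    Module.finrank k (Forms k n e) = (n + e - 1).choose e := by
  classical
  let ι := {x // x ∈ (Finset.univ : Finset (Fin n)).finsuppAntidiag e}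
  have hdeg : ∀ i : ι, i.1.degree = e := by
    intro i
    have := (Finset.mem_finsuppAntidiag.1 i.2).1
    simpa [Finsupp.degree_eq_sum] using this
  have h := finrank_common_ker _
    (li_coH (k := k) (n := n) (e := e) (fun i : ι => i.1) Subtype.val_injective hdeg)
  have hbot : (⨅ i : ι, LinearMap.ker (coH (k := k) e i.1)) = ⊥ := by
    rw [eq_bot_iff]
    intro f hf
    simp only [Submodule.mem_iInf, LinearMap.mem_ker, coH_apply] at hf
    rw [Submodule.mem_bot]
    apply Subtype.ext
    ext m
    by_cases hm : m.degree = e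
    · refine hf ⟨m, ?_⟩
      rw [Finset.mem_finsuppAntidiag]
      refine ⟨?_, Finset.subset_univ _⟩
      simpa [Finsupp.degree_eq_sum] using hm
    · have := MvPolynomial.IsHomogeneous.coeff_eq_zero (f.2) hm
      simpa using this
  rw [hbot, finrank_bot, zero_add] at h
  rw [← h]
  simp only [ι, Fintype.card_coe]
  rw [Finset.card_finsuppAntidiag_nat_eq_choose]
  simp

/-- Independence of evaluations is a Zariski open condition. -/
lemma open_li {n e : ℕ} {ι σ : Type} [Fintype ι] (pts : ι → Fin n → MvPolynomial σ k) (θ₀ : σ → k)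
    (h : LinearIndependent k
      (fun i => evH (k := k) e (fun j => MvPolynomial.eval θ₀ (pts i j)))) :
    ∃ p : MvPolynomial σ k, p ≠ 0 ∧ ∀ θ, MvPolynomial.eval θ p ≠ 0 →
      LinearIndependent k
        (fun i => evH (k := k) e (fun j => MvPolynomial.eval θ (pts i j))) := by
  classical
  obtain ⟨f, hf⟩ := exists_dual_family _ h
  let M : Matrix ι ι (MvPolynomial σ k) :=
    Matrix.of fun i j => MvPolynomial.aeval (pts i) (f j).1
  have hM : ∀ θ, MvPolynomial.eval θ M.det = (Matrix.of fun i j =>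
      evH (k := k) e (fun l => MvPolynomial.eval θ (pts i l)) (f j)).det := by
    intro θ
    rw [RingHom.map_det]
    congr 1
    ext i j
    simp only [RingHom.mapMatrix_apply, Matrix.map_apply, Matrix.of_apply, M, evH_apply]
    rw [MvPolynomial.aeval_def, ← MvPolynomial.coe_eval₂Hom, ← RingHom.comp_apply]
    have : (MvPolynomial.eval θ).comp
        (MvPolynomial.eval₂Hom (algebraMap k (MvPolynomial σ k)) (pts i)) =
        MvPolynomial.eval (fun l => MvPolynomial.eval θ (pts i l)) := by
      ext <;> simp
    rw [this]
  refine ⟨M.det, ?_, ?_⟩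
  · intro h0
    have := hM θ₀
    rw [h0, map_zero] at this
    have h1 : (Matrix.of fun i j =>
      evH (k := k) e (fun l => MvPolynomial.eval θ₀ (pts i l)) (f j)) = 1 := by
      ext i j
      simp [hf, Matrix.one_apply]
    rw [h1, Matrix.det_one] at this
    exact zero_ne_one this
  · intro θ hθ
    rw [hM] at hθ
    exact li_of_det _ f hθ

/-- Two nonzero polynomials have a common nonvanishing point. -/
lemma exists_common [Infinite k] {σ : Type} (p q r : MvPolynomial σ k) (hp : p ≠ 0) (hq : q ≠ 0)
    (hr : r ≠ 0) :
    ∃ θ, MvPolynomial.eval θ p ≠ 0 ∧ MvPolynomial.eval θ q ≠ 0 ∧ MvPolynomial.eval θ r ≠ 0 := by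
  by_contra! hcon
  have : p * q * r = 0 := by
    apply MvPolynomial.funext
    intro θ
    by_cases h1 : MvPolynomial.eval θ p = 0
    · simp [h1]
    by_cases h2 : MvPolynomial.eval θ q = 0
    · simp [h2]
    simp [hcon θ h1 h2]
  exact (mul_ne_zero (mul_ne_zero hp hq) hr) this

/-- Multiplication by a form of degree `a`. -/
noncomputable def mulH {n a e d : ℕ} (q : MvPolynomial (Fin n) k) (hq : q.IsHomogeneous a)
    (h : a + e = d) : Forms k n e →ₗ[k] Forms k n d :=
  ((LinearMap.mulLeft k q).comp (Submodule.subtype _)).codRestrict _ (by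
    intro f
    subst h
    exact hq.mul f.2)

lemma mulH_coe {n a e d : ℕ} (q : MvPolynomial (Fin n) k) (hq : q.IsHomogeneous a)
    (h : a + e = d) (f : Forms k n e) : (mulH q hq h f).1 = q * f.1 := rfl

/-- If a form vanishes at `d+1` points of a line with independent evaluations, then it vanishes
on the line. -/
lemma vanish_on_line {n d : ℕ} (u v : Fin n → k) {ι : Type} [Fintype ι]
    (hcard : Fintype.card ι = d + 1) (a b : ι → k)
    (h : LinearIndependent k (fun i => evH (k := k) d (a i • u + b i • v)))
    (f : Forms k n d) (hf : ∀ i, MvPolynomial.eval (a i • u + b i • v) f.1 = 0) (s t : k) :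
    MvPolynomial.eval (s • u + t • v) f.1 = 0 := by
  classical
  let lin : Fin n → MvPolynomial (Fin 2) k := fun j =>
    MvPolynomial.C (u j) * MvPolynomial.X 0 + MvPolynomial.C (v j) * MvPolynomial.X 1
  have hlin : ∀ j, (lin j).IsHomogeneous 1 := fun j =>
    (MvPolynomial.isHomogeneous_C_mul_X _ _).add (MvPolynomial.isHomogeneous_C_mul_X _ _)
  let ρ : Forms k n d →ₗ[k] Forms k 2 d :=
    ((MvPolynomial.aeval lin).toLinearMap.comp (Submodule.subtype _)).codRestrict _ (by
      intro f
      have := MvPolynomial.IsHomogeneous.aeval f.2 (g := lin) (n := 1) hlin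
      simpa using this)
  have hρ : ∀ (a b : k) (f : Forms k n d), evH d ![a, b] (ρ f) = evH d (a • u + b • v) f := by
    intro a b f
    simp only [evH_apply]
    change MvPolynomial.eval ![a, b] (MvPolynomial.aeval lin f.1) = _
    rw [MvPolynomial.aeval_def, ← MvPolynomial.coe_eval₂Hom, ← RingHom.comp_apply]
    congr 1
    ext j
    · simp
    · simp [lin, mul_comm]
  have hli : LinearIndependent k (fun i => evH (k := k) d ![a i, b i]) := by
    refine LinearIndependent.of_comp (LinearMap.lcomp k k ρ) ?_
    convert h using 1
    ext i f
    simp [hρ]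
  have hk := finrank_common_ker _ hli
  rw [finrank_forms 2 d, hcard] at hk
  have h2 : (2 + d - 1).choose d = d + 1 := by
    rw [show 2 + d - 1 = d + 1 by omega, Nat.choose_succ_self_right]
  rw [h2] at hk
  have hbot : (⨅ i, LinearMap.ker (evH (k := k) d ![a i, b i])) = ⊥ := by
    apply Submodule.finrank_eq_zero.1
    omega
  have hmem : ρ f ∈ (⨅ i, LinearMap.ker (evH (k := k) d ![a i, b i])) := by
    simp only [Submodule.mem_iInf, LinearMap.mem_ker, hρ]
    intro i
    rw [evH_apply]
    exact hf i
  rw [hbot, Submodule.mem_bot] at hmem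
  rw [← evH_apply, ← hρ, hmem, map_zero]

end Evaluation

section Lines

variable {k : Type} [Field k]

/-- Point of the quadric `x₀ x₃ = x₁ x₂`. -/
def qp {R : Type} [CommRing R] (s t : R) : Fin 4 → R := ![1, s, t, s * t]

/-- Point on the secant line through `qp (x 0) (x 1)` and `qp (x 2) (x 3)`. -/
def secp {R : Type} [CommRing R] (x : Fin 4 → R) (τ : R) : Fin 4 → R :=
  fun j => (1 - τ) * qp (x 0) (x 1) j + τ * qp (x 2) (x 3) j

lemma map_qp {R S : Type} [CommRing R] [CommRing S] (f : R →+* S) (s t : R) (j : Fin 4) :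
    f (qp s t j) = qp (f s) (f t) j := by
  fin_cases j <;> simp [qp]

lemma map_secp {R S : Type} [CommRing R] [CommRing S] (f : R →+* S) (x : Fin 4 → R) (τ : R)
    (j : Fin 4) : f (secp x τ j) = secp (fun i => f (x i)) (f τ) j := by
  simp [secp, map_qp]

/-- `P = e₀` together with a family of secant lines (with chosen points) impose independent
conditions in degree `e`. -/
def LinesOK (k : Type) [Field k] (e : ℕ) (ι κ : Type) : Prop :=
  ∃ (x : ι → Fin 4 → k) (τ : ι → κ → k), LinearIndependent k
    (fun o : Option (ι × κ) =>
      evH (k := k) e (o.elim (qp 0 0) (fun im => secp (x im.1) (τ im.1 im.2))))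

lemma LinesOK.of_injective {e : ℕ} {ι κ ι' κ' : Type} (h : LinesOK k e ι κ) (f : ι' → ι)
    (g : κ' → κ) (hf : Function.Injective f) (hg : Function.Injective g) :
    LinesOK k e ι' κ' := by
  obtain ⟨x, τ, h⟩ := h
  refine ⟨fun i => x (f i), fun i m => τ (f i) (g m), ?_⟩
  have := h.comp (Option.map (Prod.map f g)) (Option.map_injective (hf.prodMap hg))
  convert this using 1
  ext1 o
  rcases o with _ | ⟨i, m⟩ <;> rfl

/-- The linear form cutting the two lines of the quadric through `qp a b`. -/
noncomputable def tanForm (a b : k) : MvPolynomial (Fin 4) k :=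
  X 3 - C b * X 1 - C a * X 2 + C (a * b) * X 0

lemma tanForm_hom (a b : k) : (tanForm a b).IsHomogeneous 1 :=
  (((isHomogeneous_X _ _).sub (isHomogeneous_C_mul_X _ _)).sub (isHomogeneous_C_mul_X _ _)).add
    (isHomogeneous_C_mul_X _ _)

lemma tanForm_eval (a b s t : k) : eval (qp s t) (tanForm a b) = (s - a) * (t - b) := by
  simp [tanForm, qp]
  ring

lemma li_grid {e : ℕ} (α β : Fin (e+1) → k) (hα : Function.Injective α)
    (hβ : Function.Injective β) :
    LinearIndependent k (fun p : Fin (e+1) × Fin (e+1) => evH (k := k) e (qp (α p.1) (β p.2))) := by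
  refine li_of_dual _ (fun p => ⟨∏ m : Fin e, tanForm (α (p.1.succAbove m)) (β (p.2.succAbove m)),
    ?_⟩) ?_ ?_
  · have := MvPolynomial.IsHomogeneous.prod (Finset.univ : Finset (Fin e))
      (fun m => tanForm (α (p.1.succAbove m)) (β (p.2.succAbove m))) (fun _ => 1)
      (fun m _ => tanForm_hom _ _)
    simpa using this
  · intro p
    rw [evH_apply, map_prod, Finset.prod_ne_zero_iff]
    intro m _
    rw [tanForm_eval]
    refine mul_ne_zero (sub_ne_zero.2 fun h => ?_) (sub_ne_zero.2 fun h => ?_)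
    · exact Fin.succAbove_ne _ _ (hα h).symm
    · exact Fin.succAbove_ne _ _ (hβ h).symm
  · intro p p' hpp
    rw [evH_apply, map_prod, Finset.prod_eq_zero_iff]
    by_cases h1 : p.1 = p'.1
    · have h2 : p.2 ≠ p'.2 := fun h => hpp (Prod.ext h1 h)
      obtain ⟨m, hm⟩ := Fin.exists_succAbove_eq h2
      exact ⟨m, Finset.mem_univ _, by rw [tanForm_eval, hm]; simp⟩
    · obtain ⟨m, hm⟩ := Fin.exists_succAbove_eq h1
      exact ⟨m, Finset.mem_univ _, by rw [tanForm_eval, hm]; simp⟩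

/-- The quadric. -/
noncomputable def quadric (k : Type) [Field k] : MvPolynomial (Fin 4) k := X 0 * X 3 - X 1 * X 2

lemma quadric_hom : (quadric k).IsHomogeneous 2 :=
  ((isHomogeneous_X _ _).mul (isHomogeneous_X _ _)).sub
    ((isHomogeneous_X _ _).mul (isHomogeneous_X _ _))

lemma quadric_qp (s t : k) : eval (qp s t) (quadric k) = 0 := by
  simp [quadric, qp]

lemma quadric_secp (x : Fin 4 → k) (τ : k) :
    eval (secp x τ) (quadric k) = τ * (1 - τ) * ((x 0 - x 2) * (x 1 - x 3)) := by
  simp [quadric, qp, secp]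
  ring

/-- Reindexing used in the induction step. -/
def stepIdx {q : ℕ} {ι κ : Type} : Option ((Fin q ⊕ ι) × (κ ⊕ Fin 2)) →
    ((Option (Fin q × (κ ⊕ Fin 2))) ⊕ (ι × Fin 2)) ⊕ (ι × κ)
  | none => .inl (.inl none)
  | some (.inl i, m) => .inl (.inl (some (i, m)))
  | some (.inr i, .inl m) => .inr (i, m)
  | some (.inr i, .inr a) => .inl (.inr (i, a))

lemma stepIdx_injective {q : ℕ} {ι κ : Type} :
    Function.Injective (stepIdx (q := q) (ι := ι) (κ := κ)) := by
  rintro (_ | ⟨i | i, m | m⟩) (_ | ⟨j | j, n | n⟩) h <;> simp_all [stepIdx]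

lemma lines_grid [CharZero k] {e q : ℕ} {ι K : Type} [Fintype ι] [Fintype K]
    (hK : Fintype.card K = e + 1) (hn : (e+1) * q + 2 * Fintype.card ι + 1 ≤ (e+1)^2) :
    ∃ (b : K → k) (y : ι → Fin 4 → k), LinearIndependent k
      (fun o : (Option (Fin q × K)) ⊕ (ι × Fin 2) => evH (k := k) e
        (Sum.elim (fun o => o.elim (qp 0 0) (fun im => qp ((im.1 : ℕ) + 1 : k) (b im.2)))
          (fun ia => qp (y ia.1 (![0, 2] ia.2)) (y ia.1 (![1, 3] ia.2))) o)) := by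
  classical
  have hq : q < e + 1 := by nlinarith
  let eK : K ≃ Fin (e+1) := Fintype.equivFinOfCardEq hK
  let cst : Fin (e+1) → k := fun i => ((i : ℕ) : k)
  have hcst : Function.Injective cst := fun i j h => by
    apply Fin.ext
    have h' : ((i : ℕ) : k) = ((j : ℕ) : k) := h
    exact_mod_cast h'
  let j0 : Option (Fin q × K) → Fin (e+1) × Fin (e+1) := fun o =>
    o.elim (0, 0) (fun im => (⟨im.1 + 1, by omega⟩, eK im.2))
  have hj0 : Function.Injective j0 := by
    rintro (_ | ⟨i, m⟩) (_ | ⟨j, n⟩) h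
    · rfl
    · have := congrArg (fun p => (p.1 : ℕ)) h
      simp [j0] at this
    · have := congrArg (fun p => (p.1 : ℕ)) h
      simp [j0] at this
    · have h1 := congrArg (fun p => (p.1 : ℕ)) h
      have h2 : eK m = eK n := congrArg (fun p => p.2) h
      simp only [j0, Option.elim, Nat.add_right_cancel_iff] at h1
      rw [eK.injective h2, Fin.ext h1]
  have hcard : Fintype.card (ι × Fin 2) ≤ Fintype.card {p // p ∉ Set.range j0} := by
    have h1 := Fintype.card_subtype_compl (fun p => p ∈ Set.range j0)
    have h2 : Fintype.card {p // p ∈ Set.range j0} = Fintype.card (Option (Fin q × K)) :=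
      Set.card_range_of_injective hj0
    rw [h1, h2]
    simp only [Fintype.card_prod, Fintype.card_option, Fintype.card_fin, hK]
    have : q * (e + 1) + 1 + Fintype.card ι * 2 ≤ (e+1) * (e+1) := by nlinarith
    omega
  obtain ⟨g⟩ := Function.Embedding.nonempty_of_card_le hcard
  let J : (Option (Fin q × K)) ⊕ (ι × Fin 2) → Fin (e+1) × Fin (e+1) :=
    Sum.elim j0 (fun x => (g x).1)
  have hJ : Function.Injective J := by
    refine Function.Injective.sumElim hj0 (Subtype.val_injective.comp g.injective) ?_
    intro a b h
    exact (g b).2 ⟨a, h⟩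
  refine ⟨fun m => cst (eK m), fun i => ![cst (g (i, 0)).1.1, cst (g (i, 0)).1.2,
    cst (g (i, 1)).1.1, cst (g (i, 1)).1.2], ?_⟩
  have := (li_grid cst cst hcst hcst).comp J hJ
  convert this using 1
  ext1 o
  rcases o with (_ | ⟨i, m⟩) | ⟨i, a⟩
  · simp [J, j0, cst]
  · simp [J, j0, cst]
  · fin_cases a <;> simp [J, cst]

lemma lines_step [CharZero k] {e q : ℕ} {ι κ : Type} [Fintype ι] [Fintype κ]
    (hκ : Fintype.card κ = e + 1)
    (hn : (e+3) * q + 2 * Fintype.card ι + 1 ≤ (e+3)^2) (h : LinesOK k e ι κ) :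
    LinesOK k (e+2) (Fin q ⊕ ι) (κ ⊕ Fin 2) := by
  classical
  obtain ⟨x₀, τ₀, h⟩ := h
  obtain ⟨b, y, hy⟩ := lines_grid (k := k) (e := e + 2) (q := q) (ι := ι) (K := κ ⊕ Fin 2)
    (by simp [hκ]) hn
  let σ := ι × (Fin 4 ⊕ κ)
  let xP : ι → Fin 4 → MvPolynomial σ k := fun i j => X (i, .inl j)
  let τP : ι → κ → MvPolynomial σ k := fun i m => X (i, .inr m)
  let pts1 : ι × κ → Fin 4 → MvPolynomial σ k := fun im => secp (xP im.1) (τP im.1 im.2)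
  let pts2 : (Option (Fin q × (κ ⊕ Fin 2))) ⊕ (ι × Fin 2) → Fin 4 → MvPolynomial σ k :=
    Sum.elim (fun o => o.elim (qp 0 0) (fun im => qp (C ((im.1 : ℕ) + 1 : k)) (C (b im.2))))
          (fun ia => qp (xP ia.1 (![0, 2] ia.2)) (xP ia.1 (![1, 3] ia.2)))
  have e1 : ∀ θ : σ → k, ∀ im, (fun j => eval θ (pts1 im j)) =
      secp (fun j => θ (im.1, .inl j)) (θ (im.1, .inr im.2)) := by
    intro θ im
    ext j
    simp [pts1, map_secp, xP, τP]
  have e2 : ∀ θ : σ → k, ∀ o, (fun j => eval θ (pts2 o j)) =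
      Sum.elim (fun o => o.elim (qp 0 0) (fun im => qp ((im.1 : ℕ) + 1 : k) (b im.2)))
          (fun ia => qp (θ (ia.1, .inl (![0, 2] ia.2))) (θ (ia.1, .inl (![1, 3] ia.2)))) o := by
    intro θ o
    ext j
    rcases o with (_ | ⟨i, m⟩) | ⟨i, a⟩ <;> simp [pts2, map_qp, xP]
  obtain ⟨p, hp0, hp⟩ := open_li (k := k) (e := e) pts1
    (fun s => Sum.elim (fun j => x₀ s.1 j) (fun m => τ₀ s.1 m) s.2) (by
      have := h.comp some (Option.some_injective _)
      convert this using 1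
      ext1 im
      rw [e1]
      rfl)
  obtain ⟨p', hp0', hp'⟩ := open_li (k := k) (e := e + 2) pts2
    (fun s => Sum.elim (fun j => y s.1 j) (fun m => 0) s.2) (by
      convert hy using 1
      ext1 o
      rw [e2]
      rfl)
  let r : MvPolynomial σ k := ∏ im : ι × κ, (τP im.1 im.2 * (1 - τP im.1 im.2) *
    ((xP im.1 0 - xP im.1 2) * (xP im.1 1 - xP im.1 3)))
  have hr0 : r ≠ 0 := by
    rw [Finset.prod_ne_zero_iff]
    rintro ⟨i, m⟩ _ h0
    have := congrArg (eval (fun s : σ =>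
      Sum.elim (fun j => (![2, 2, 0, 0] : Fin 4 → k) j) (fun _ => (2 : k)) s.2)) h0
    simp [xP, τP] at this
    norm_num at this
  obtain ⟨θ, h1, h2, h3⟩ := exists_common p p' r hp0 hp0' hr0
  replace h1 := hp θ h1
  replace h2 := hp' θ h2
  simp only [e1] at h1
  simp only [e2] at h2
  have h3' : ∀ i m, θ (i, .inr m) * (1 - θ (i, .inr m)) *
      ((θ (i, .inl 0) - θ (i, .inl 2)) * (θ (i, .inl 1) - θ (i, .inl 3))) ≠ 0 := by
    intro i m
    simp only [r, map_prod, Finset.prod_ne_zero_iff] at h3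
    have := h3 (i, m) (Finset.mem_univ _)
    simpa [xP, τP] using this
  have key := li_triangular _ (fun im : ι × κ => evH (k := k) (e + 2)
      (secp (fun j => θ (im.1, .inl j)) (θ (im.1, .inr im.2)))) _
      (mulH (quadric k) quadric_hom (by omega : 2 + e = e + 2))
      (fun im => eval (secp (fun j => θ (im.1, .inl j)) (θ (im.1, .inr im.2))) (quadric k))
      (by
        rintro ⟨i, m⟩
        rw [quadric_secp]
        exact h3' i m) h2 h1
      (by
        intro o f
        rw [evH_apply, mulH_coe, map_mul]
        rcases o with (_ | ⟨i, m⟩) | ⟨i, a⟩ <;> simp [quadric_qp])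
      (by
        intro im f
        rw [evH_apply, evH_apply, mulH_coe, map_mul])
  refine ⟨Sum.elim (fun i => ![((i : ℕ) + 1 : k), 0, ((i : ℕ) + 1 : k), 1])
    (fun i j => θ (i, .inl j)), Sum.elim (fun i m => b m)
    (fun i => Sum.elim (fun m => θ (i, .inr m)) ![0, 1]), ?_⟩
  have := key.comp stepIdx stepIdx_injective
  convert this using 1
  ext1 o
  rcases o with (_ | ⟨i | i, m | a⟩)
  · rfl
  · simp only [Function.comp, stepIdx, Sum.elim_inl, Option.elim]
    congr 1
    ext j
    fin_cases j <;> simp [secp, qp] <;> ring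
  · simp only [Function.comp, stepIdx, Sum.elim_inl, Option.elim]
    congr 1
    ext j
    fin_cases j <;> simp [secp, qp] <;> ring
  · rfl
  · simp only [Function.comp, stepIdx, Sum.elim_inl, Sum.elim_inr, Option.elim]
    congr 1
    ext j
    fin_cases a <;> simp [secp]

end Lines

section AllLines

variable {k : Type} [Field k] [CharZero k]

lemma lines_base {e q : ℕ} {K : Type} [Fintype K] (hK : Fintype.card K = e + 1)
    (hn : (e+1) * q + 1 ≤ (e+1)^2) : LinesOK k e (Fin q) K := by
  obtain ⟨b, y, hy⟩ := lines_grid (k := k) (e := e) (q := q) (ι := Empty) (K := K) hK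
    (by simpa using hn)
  refine ⟨fun i => ![((i : ℕ) + 1 : k), 0, ((i : ℕ) + 1 : k), 1], fun i m => b m, ?_⟩
  have := hy.comp Sum.inl Sum.inl_injective
  convert this using 1
  ext1 o
  rcases o with (_ | ⟨i, m⟩)
  · rfl
  · simp only [Function.comp, Sum.elim_inl, Option.elim]
    congr 1
    ext j
    fin_cases j <;> simp [secp, qp] <;> ring

/-- Number of lines used in degree `e`. -/
def numL (e : ℕ) : ℕ := ((e+3)*(e+4)+7)/8 - 2

lemma numL_step (e : ℕ) : numL e ≤ numL (e+2) ∧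
    (e+3) * (numL (e+2) - numL e) + 2 * numL e + 1 ≤ (e+3)^2 := by
  rcases Nat.lt_or_ge e 4 with h | h
  · interval_cases e <;> decide
  · unfold numL
    set A := ((e+3)*(e+4)+7)/8 with hA
    set B := ((e+2+3)*(e+2+4)+7)/8 with hB
    have hX : (e+2+3)*(e+2+4) = (e+3)*(e+4) + 4*e+18 := by ring
    rw [hX] at hB
    have hlow : 56 ≤ (e+3)*(e+4) := by nlinarith
    set X := (e+3)*(e+4) with hXX
    have h1 : 8 * B ≤ X + 4*e + 25 := by omega
    have h2 : X ≤ 8 * A := by omega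
    have h3 : 8 * A ≤ X + 7 := by omega
    have h4 : A ≤ B := by omega
    have h5 : 2 ≤ A := by omega
    obtain ⟨D, hD⟩ := Nat.exists_eq_add_of_le h4
    obtain ⟨n, hn⟩ := Nat.exists_eq_add_of_le h5
    refine ⟨by omega, ?_⟩
    rw [show B - 2 - (A - 2) = D by omega, show A - 2 = n by omega]
    have h6 : 8 * D ≤ 4 * e + 25 := by omega
    have h7 : 8 * n ≤ X - 9 := by omega
    have h8 : 8 * n + 9 ≤ (e+3)*(e+4) := by omega
    have h9 : (e+3) * (8 * D) ≤ (e+3) * (4*e+25) := Nat.mul_le_mul_left _ h6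
    nlinarith

lemma lines_all : ∀ e, LinesOK k e (Fin (numL e)) (Fin (e+1)) := by
  have key : ∀ e, LinesOK k e (Fin (numL e)) (Fin (e+1)) ∧
      LinesOK k (e+1) (Fin (numL (e+1))) (Fin (e+1+1)) := by
    intro e
    induction e with
    | zero => exact ⟨lines_base (by simp) (by decide), lines_base (by simp) (by decide)⟩
    | succ e ih =>
      refine ⟨ih.2, ?_⟩
      obtain ⟨h1, h2⟩ := numL_step e
      have := lines_step (k := k) (e := e) (q := numL (e+2) - numL e) (ι := Fin (numL e))
        (κ := Fin (e+1)) (by simp) (by simpa using h2) ih.1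
      let e1 : Fin (numL (e+1+1)) ≃ Fin (numL (e+2) - numL e) ⊕ Fin (numL e) :=
        (Fintype.equivFinOfCardEq (by
          have : numL (e+2) - numL e + numL e = numL (e+1+1) := by
            change numL (e+2) - numL e + numL e = numL (e+2)
            omega
          simpa using this)).symm
      let e2 : Fin (e+1+1+1) ≃ Fin (e+1) ⊕ Fin 2 :=
        (Fintype.equivFinOfCardEq (by simp)).symm
      exact this.of_injective e1 e2 e1.injective e2.injective
  exact fun e => (key e).1

end AllLines

section Top

variable {k : Type} [Field k]

/-- Intersection of a secant line with the plane `x₃ = 0`. -/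
def hyp {R : Type} [CommRing R] (x : Fin 4 → R) : Fin 4 → R :=
  fun j => x 2 * x 3 * qp (x 0) (x 1) j - x 0 * x 1 * qp (x 2) (x 3) j

lemma map_hyp {R S : Type} [CommRing R] [CommRing S] (f : R →+* S) (x : Fin 4 → R) (j : Fin 4) :
    f (hyp x j) = hyp (fun i => f (x i)) j := by
  simp [hyp, map_qp]

lemma hyp_three {R : Type} [CommRing R] (x : Fin 4 → R) : hyp x 3 = 0 := by
  simp [hyp, qp]
  ring

/-- Monomials of degree `d` supported on the degenerate conic. -/
noncomputable def conMon (d : ℕ) : Fin (d+1) ⊕ Fin d → (Fin 4 →₀ ℕ)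
  | .inl i => Finsupp.single 0 (d - i) + Finsupp.single 1 (i : ℕ)
  | .inr i => Finsupp.single 0 (d - 1 - i) + Finsupp.single 2 ((i : ℕ) + 1)

lemma conMon_inj (d : ℕ) : Function.Injective (conMon d) := by
  rintro (i | i) (j | j) h
  · have := DFunLike.congr_fun h 1
    simp [conMon] at this
    rw [Fin.ext this]
  · have := DFunLike.congr_fun h 2
    simp [conMon] at this
  · have := DFunLike.congr_fun h 2
    simp [conMon] at this
  · have := DFunLike.congr_fun h 2
    simp [conMon] at this
    rw [Fin.ext this]

lemma conMon_deg (d : ℕ) (s) : (conMon d s).degree = d := by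
  rcases s with i | i
  · simp only [conMon, map_add, Finsupp.degree_single]
    omega
  · simp only [conMon, map_add, Finsupp.degree_single]
    omega

lemma conMon_three (d : ℕ) (s) : conMon d s 3 = 0 := by
  rcases s with i | i <;> simp [conMon]

lemma conMon_onetwo (d : ℕ) (s) : conMon d s 1 = 0 ∨ conMon d s 2 = 0 := by
  rcases s with i | i <;> simp [conMon]

lemma eval_e0 {e : ℕ} (f : Forms k 4 e) :
    eval (qp 0 0) f.1 = coeff (Finsupp.single 0 e) f.1 := by
  rw [eval_eq']
  rw [Finset.sum_eq_single (Finsupp.single 0 e)]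
  · simp [Fin.prod_univ_four, qp]
  · intro m hm hne
    have hdeg : m.degree = e := f.2.degree_eq_sum_deg_support hm |>.symm
    have : m 1 ≠ 0 ∨ m 2 ≠ 0 ∨ m 3 ≠ 0 := by
      by_contra! hcon
      apply hne
      simp [Finsupp.degree_eq_sum, Fin.sum_univ_four, hcon] at hdeg
      ext j
      fin_cases j <;> simp [hcon, hdeg]
    simp only [Fin.prod_univ_four, qp]
    rcases this with h | h | h <;> simp [h]
  · intro hm
    rw [notMem_support_iff.1 hm, zero_mul]

lemma li_hyp [CharZero k] {e p r : ℕ} {ι : Type} [Fintype ι] (hpr : p + r = e)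
    (hι : Fintype.card ι ≤ (p+1)*(r+1)) :
    ∃ x : ι → Fin 4 → k, LinearIndependent k (fun i => evH (k := k) e (hyp (x i))) := by
  classical
  have hc : Fintype.card ι ≤ Fintype.card (Fin (p+1) × Fin (r+1)) := by simpa using hι
  obtain ⟨g⟩ := Function.Embedding.nonempty_of_card_le hc
  let Y : Fin (p+1) → k := fun i => (i : ℕ) + 2
  let Z : Fin (r+1) → k := fun i => (i : ℕ) + 2
  have hYi : Function.Injective Y := by
    intro i j h
    have h' : ((i : ℕ) : k) + 2 = ((j : ℕ) : k) + 2 := h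
    apply Fin.ext
    exact_mod_cast add_right_cancel h'
  have hZi : Function.Injective Z := by
    intro i j h
    have h' : ((i : ℕ) : k) + 2 = ((j : ℕ) : k) + 2 := h
    apply Fin.ext
    exact_mod_cast add_right_cancel h'
  have hY : ∀ i, 1 - Y i ≠ 0 := by
    intro i h
    have : ((i : ℕ) : k) + 1 = 0 := by simp only [Y] at h; linear_combination -h
    exact Nat.cast_add_one_ne_zero _ this
  have hZ : ∀ i, 1 - Z i ≠ 0 := by
    intro i h
    have : ((i : ℕ) : k) + 1 = 0 := by simp only [Z] at h; linear_combination -h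
    exact Nat.cast_add_one_ne_zero _ this
  have hYZ : ∀ i j, Y i + Z j - 1 ≠ 0 := by
    intro i j h
    have : ((i + j + 2 : ℕ) : k) + 1 = 0 := by
      simp only [Y, Z] at h; push_cast; linear_combination h
    exact Nat.cast_add_one_ne_zero _ this
  let x : Fin (p+1) × Fin (r+1) → Fin 4 → k := fun q =>
    ![1, 1, Y q.1 / (1 - Z q.2), Z q.2 / (1 - Y q.1)]
  let ρ : Fin (p+1) × Fin (r+1) → k := fun q =>
    (Y q.1 + Z q.2 - 1) / ((1 - Y q.1) * (1 - Z q.2))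
  have hρ : ∀ q, ρ q ≠ 0 := fun q => div_ne_zero (hYZ _ _) (mul_ne_zero (hY _) (hZ _))
  have hx : ∀ q, hyp (x q) = ![ρ q, ρ q * Y q.1, ρ q * Z q.2, 0] := by
    intro q
    have h1 := hY q.1
    have h2 := hZ q.2
    ext j
    fin_cases j
    · simp [hyp, qp, x, ρ]
      field_simp
      ring
    · simp [hyp, qp, x, ρ]
      field_simp
      ring
    · simp [hyp, qp, x, ρ]
      field_simp
      ring
    · simp [hyp, qp, x]
  have hli : LinearIndependent k (fun q => evH (k := k) e (hyp (x q))) := by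
    refine li_of_dual _ (fun q => ⟨(∏ m : Fin p, (X 1 - C (Y (q.1.succAbove m)) * X 0)) *
      ∏ m : Fin r, (X 2 - C (Z (q.2.succAbove m)) * X 0), ?_⟩) ?_ ?_
    · have h1 := MvPolynomial.IsHomogeneous.prod (Finset.univ : Finset (Fin p))
        (fun m => (X 1 - C (Y (q.1.succAbove m)) * X 0 : MvPolynomial (Fin 4) k)) (fun _ => 1)
        (fun m _ => (isHomogeneous_X _ _).sub (isHomogeneous_C_mul_X _ _))
      have h2 := MvPolynomial.IsHomogeneous.prod (Finset.univ : Finset (Fin r))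
        (fun m => (X 2 - C (Z (q.2.succAbove m)) * X 0 : MvPolynomial (Fin 4) k)) (fun _ => 1)
        (fun m _ => (isHomogeneous_X _ _).sub (isHomogeneous_C_mul_X _ _))
      have := h1.mul h2
      simpa [hpr] using this
    · intro q
      rw [evH_apply, hx, map_mul, map_prod, map_prod]
      refine mul_ne_zero ?_ ?_
      · rw [Finset.prod_ne_zero_iff]
        intro m _
        have : Y q.1 - Y (q.1.succAbove m) ≠ 0 :=
          sub_ne_zero.2 fun h => Fin.succAbove_ne _ _ (hYi h).symm
        have h2 := mul_ne_zero (hρ q) this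
        convert h2 using 1
        simp
        ring
      · rw [Finset.prod_ne_zero_iff]
        intro m _
        have : Z q.2 - Z (q.2.succAbove m) ≠ 0 :=
          sub_ne_zero.2 fun h => Fin.succAbove_ne _ _ (hZi h).symm
        have h2 := mul_ne_zero (hρ q) this
        convert h2 using 1
        simp
        ring
    · intro q q' hqq
      rw [evH_apply, hx, map_mul, map_prod, map_prod]
      by_cases h1 : q.1 = q'.1
      · have h2 : q.2 ≠ q'.2 := fun h => hqq (Prod.ext h1 h)
        obtain ⟨m, hm⟩ := Fin.exists_succAbove_eq h2
        apply mul_eq_zero_of_right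
        rw [Finset.prod_eq_zero_iff]
        refine ⟨m, Finset.mem_univ _, ?_⟩
        simp [hm]
        ring
      · obtain ⟨m, hm⟩ := Fin.exists_succAbove_eq h1
        apply mul_eq_zero_of_left
        rw [Finset.prod_eq_zero_iff]
        refine ⟨m, Finset.mem_univ _, ?_⟩
        simp [hm]
        ring
  exact ⟨fun i => x (g i), hli.comp g g.injective⟩

/-- Functionals of the sundial. -/
noncomputable def sunFun (k : Type) [Field k] (d : ℕ) :
    Option (Fin (d+1) ⊕ Fin d) → Module.Dual k (Forms k 4 d)
  | none => coH d (Finsupp.single 0 (d-1) + Finsupp.single 3 1)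
  | some s => coH d (conMon d s)

/-- Reindexing for the last step. -/
def topIdx {A ι κ : Type} : (Option A) ⊕ (ι × Option κ) → (A ⊕ ι) ⊕ Option (ι × κ)
  | .inl none => .inr none
  | .inl (some s) => .inl (.inl s)
  | .inr (i, none) => .inl (.inr i)
  | .inr (i, some m) => .inr (some (i, m))

lemma topIdx_injective {A ι κ : Type} : Function.Injective (topIdx (A := A) (ι := ι) (κ := κ)) := by
  rintro ((_ | a) | ⟨i, _ | m⟩) ((_ | b) | ⟨j, _ | n⟩) h <;> simp_all [topIdx]

lemma top_step [CharZero k] {e p r : ℕ} {ι κ : Type} [Fintype ι] [Fintype κ] (hpr : p + r = e)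
    (hι : Fintype.card ι ≤ (p+1)*(r+1)) (h : LinesOK k (e+1) ι κ) :
    ∃ (u v : ι → Fin 4 → k) (a b : ι → Option κ → k),
      (∀ i, LinearIndependent k ![u i, v i]) ∧
      LinearIndependent k (Sum.elim (sunFun k (e+2))
        (fun io : ι × Option κ => evH (k := k) (e+2)
          (a io.1 io.2 • u io.1 + b io.1 io.2 • v io.1))) := by
  classical
  obtain ⟨x₀, τ₀, h⟩ := h
  obtain ⟨y, hy⟩ := li_hyp (k := k) hpr hι
  let σ := ι × (Fin 4 ⊕ κ)
  let xP : ι → Fin 4 → MvPolynomial σ k := fun i j => X (i, .inl j)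
  let τP : ι → κ → MvPolynomial σ k := fun i m => X (i, .inr m)
  let pts1 : Option (ι × κ) → Fin 4 → MvPolynomial σ k := fun o =>
    o.elim (qp 0 0) (fun im => secp (xP im.1) (τP im.1 im.2))
  let pts2 : ι → Fin 4 → MvPolynomial σ k := fun i => hyp (xP i)
  have e1 : ∀ θ : σ → k, ∀ o, (fun j => eval θ (pts1 o j)) =
      o.elim (qp 0 0) (fun im => secp (fun j => θ (im.1, .inl j)) (θ (im.1, .inr im.2))) := by
    intro θ o
    ext j
    rcases o with _ | im <;> simp [pts1, map_secp, map_qp, xP, τP]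
  have e2 : ∀ θ : σ → k, ∀ i, (fun j => eval θ (pts2 i j)) = hyp (fun j => θ (i, .inl j)) := by
    intro θ o
    ext j
    simp [pts2, map_hyp, xP]
  obtain ⟨p, hp0, hp⟩ := open_li (k := k) (e := e+1) pts1
    (fun s => Sum.elim (fun j => x₀ s.1 j) (fun m => τ₀ s.1 m) s.2) (by
      convert h using 1
      ext1 im
      rw [e1]
      rfl)
  obtain ⟨p', hp0', hp'⟩ := open_li (k := k) (e := e) pts2
    (fun s => Sum.elim (fun j => y s.1 j) (fun m => 0) s.2) (by
      convert hy using 1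
      ext1 o
      rw [e2]
      rfl)
  let r : MvPolynomial σ k := (∏ i : ι, (hyp (xP i) 1 * hyp (xP i) 2 * (xP i 0 - xP i 2))) *
    ∏ im : ι × κ, secp (xP im.1) (τP im.1 im.2) 3
  have hr0 : r ≠ 0 := by
    refine mul_ne_zero ?_ ?_
    · rw [Finset.prod_ne_zero_iff]
      rintro i _ h0
      have := congrArg (eval (fun s : σ =>
        Sum.elim (fun j => (![1, 1, 2, 2] : Fin 4 → k) j) (fun _ => (2 : k)) s.2)) h0
      simp [hyp, qp, xP] at this
      norm_num at this
    · rw [Finset.prod_ne_zero_iff]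
      rintro i _ h0
      have := congrArg (eval (fun s : σ => (1 : k))) h0
      simp [secp, qp, xP, τP] at this
  obtain ⟨θ, h1, h2, h3⟩ := exists_common p p' r hp0 hp0' hr0
  replace h1 := hp θ h1
  replace h2 := hp' θ h2
  simp only [e1] at h1
  simp only [e2] at h2
  have h3' := h3
  simp only [r, map_mul, mul_ne_zero_iff, map_prod, Finset.prod_ne_zero_iff] at h3'
  obtain ⟨ha, hb⟩ := h3'
  have ha' : ∀ i, hyp (fun j => θ (i, .inl j)) 1 ≠ 0 ∧ hyp (fun j => θ (i, .inl j)) 2 ≠ 0 ∧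
      θ (i, .inl 0) - θ (i, .inl 2) ≠ 0 := by
    intro i
    obtain ⟨⟨q1, q2⟩, q3⟩ := ha i (Finset.mem_univ _)
    refine ⟨?_, ?_, ?_⟩
    · simpa [map_hyp, xP] using q1
    · simpa [map_hyp, xP] using q2
    · simpa [xP] using q3
  have hb' : ∀ im : ι × κ, secp (fun j => θ (im.1, .inl j)) (θ (im.1, .inr im.2)) 3 ≠ 0 := by
    intro im
    have := hb im (Finset.mem_univ _)
    simpa [map_secp, xP, τP] using this
  have hX12 : (X 1 * X 2 : MvPolynomial (Fin 4) k).IsHomogeneous 2 :=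
    (isHomogeneous_X _ _).mul (isHomogeneous_X _ _)
  have stepA := li_triangular (fun s => coH (k := k) (e+2) (conMon (e+2) s))
    (fun i => evH (k := k) (e+2) (hyp (fun j => θ (i, .inl j)))) _
    (mulH (X 1 * X 2) hX12 (by omega : 2 + e = e + 2))
    (fun i => hyp (fun j => θ (i, .inl j)) 1 * hyp (fun j => θ (i, .inl j)) 2)
    (fun i => mul_ne_zero (ha' i).1 (ha' i).2.1)
    (li_coH (conMon (e+2)) (conMon_inj _) (conMon_deg _)) h2
    (by
      intro s f
      rw [coH_apply, mulH_coe]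
      rcases conMon_onetwo (e+2) s with hs | hs
      · rw [mul_assoc, coeff_X_mul', if_neg]
        simpa using hs
      · rw [mul_comm (X 1) (X 2), mul_assoc, coeff_X_mul', if_neg]
        simpa using hs)
    (by
      intro i f
      rw [evH_apply, evH_apply, mulH_coe]
      simp)
  have stepB := li_triangular _
    (fun o : Option (ι × κ) => o.elim (sunFun k (e+2) none) (fun im => evH (k := k) (e+2)
      (secp (fun j => θ (im.1, .inl j)) (θ (im.1, .inr im.2))))) _
    (mulH (X 3) (isHomogeneous_X _ _) (by omega : 1 + (e + 1) = e + 2))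
    (fun o => o.elim 1 (fun im => secp (fun j => θ (im.1, .inl j)) (θ (im.1, .inr im.2)) 3))
    (by
      rintro (_ | im)
      · simp
      · exact hb' im) stepA h1
    (by
      rintro (s | i) f
      · simp only [Sum.elim_inl]
        rw [coH_apply, mulH_coe, coeff_X_mul', if_neg]
        simpa using conMon_three (e+2) s
      · simp only [Sum.elim_inr]
        rw [evH_apply, mulH_coe]
        simp [hyp_three])
    (by
      rintro (_ | im) f
      · simp only [Option.elim, sunFun]
        rw [coH_apply, mulH_coe, coeff_X_mul', if_pos (by simp), evH_apply, eval_e0]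
        simp
      · simp only [Option.elim]
        rw [evH_apply, evH_apply, mulH_coe]
        simp)
  refine ⟨fun i => qp (θ (i, .inl 0)) (θ (i, .inl 1)), fun i => qp (θ (i, .inl 2)) (θ (i, .inl 3)),
    fun i o => o.elim (θ (i, .inl 2) * θ (i, .inl 3)) (fun m => 1 - θ (i, .inr m)),
    fun i o => o.elim (- (θ (i, .inl 0) * θ (i, .inl 1))) (fun m => θ (i, .inr m)), ?_, ?_⟩
  · intro i
    rw [LinearIndependent.pair_iff]
    intro a b hab
    have q0 := congrFun hab 0
    have q1 := congrFun hab 1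
    simp [qp] at q0 q1
    have hz : a * (θ (i, .inl 0) - θ (i, .inl 2)) = 0 := by
      linear_combination q1 - θ (i, .inl 2) * q0
    have ha0 : a = 0 := (mul_eq_zero.1 hz).resolve_right (ha' i).2.2
    refine ⟨ha0, ?_⟩
    simpa [ha0] using q0
  · have := stepB.comp topIdx topIdx_injective
    convert this using 1
    ext1 o
    rcases o with ((_ | s) | ⟨i, _ | m⟩)
    · rfl
    · rfl
    · simp only [Function.comp, topIdx, Sum.elim_inl, Sum.elim_inr, Option.elim]
      congr 1
      ext j
      simp [hyp]
      ring
    · simp only [Function.comp, topIdx, Sum.elim_inl, Sum.elim_inr, Option.elim]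
      congr 1

end Top
section Sundial

variable {k : Type} [Field k]

/-- Coordinate subspace. -/
noncomputable def coordSub (k : Type) [Field k] (S : Set (Fin 4)) : Submodule k (Fin 4 → k) :=
  ⨅ i ∈ Sᶜ, LinearMap.ker (LinearMap.proj (R := k) (φ := fun _ : Fin 4 => k) i)

lemma mem_coordSub (S : Set (Fin 4)) (v : Fin 4 → k) :
    v ∈ coordSub k S ↔ ∀ i, i ∉ S → v i = 0 := by
  simp [coordSub, Submodule.mem_iInf]

lemma finrank_coordSub {T : Set (Fin 4)} (S : Finset (Fin 4)) (hT : T = (S : Set (Fin 4))) :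
    Module.finrank k (coordSub k T) = S.card := by
  classical
  subst hT
  have e := LinearMap.iInfKerProjEquiv k (fun _ : Fin 4 => k)
    (I := (S : Set (Fin 4))) (J := (S : Set (Fin 4))ᶜ) disjoint_compl_right (by simp)
  rw [coordSub, e.finrank_eq]
  simp

lemma vanish_coord [Infinite k] (S : Set (Fin 4)) (f : MvPolynomial (Fin 4) k) :
    f ∈ vanIdeal k 4 (coordSub k S : Set (Fin 4 → k)) ↔
      ∀ m : Fin 4 →₀ ℕ, (∀ i, i ∉ S → m i = 0) → coeff m f = 0 := by
  classical
  constructor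
  · intro h m hm
    let φ : MvPolynomial (Fin 4) k →ₐ[k] MvPolynomial (Fin 4) k :=
      aeval (fun i => if i ∈ S then X i else 0)
    have h0 : φ f = 0 := by
      apply MvPolynomial.funext
      intro v
      have := h (fun i => if i ∈ S then v i else 0) (by
        rw [SetLike.mem_coe, mem_coordSub]
        intro i hi
        simp [hi])
      rw [map_zero, ← this]
      have hh : (eval v).comp (φ : MvPolynomial (Fin 4) k →+* MvPolynomial (Fin 4) k) =
          eval (fun i => if i ∈ S then v i else 0) := by
        ext i
        · simp
        · by_cases hi : i ∈ S <;> simp [φ, hi]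
      rw [← hh]
      rfl
    have h1 : ∀ g : MvPolynomial (Fin 4) k, coeff m (φ g) = coeff m g := by
      intro g
      induction g using MvPolynomial.induction_on' with
      | monomial n a =>
        by_cases hn : ∀ i, i ∉ S → n i = 0
        · have : φ (monomial n a) = monomial n a := by
            simp only [φ, aeval_monomial]
            rw [monomial_eq]
            congr 1
            apply Finsupp.prod_congr
            intro i hi
            rw [if_pos]
            by_contra hS
            exact (Finsupp.mem_support_iff.1 hi) (hn i hS)
          rw [this]
        · push Not at hn
          obtain ⟨i, hi, hni⟩ := hn
          have : φ (monomial n a) = 0 := by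
            simp only [φ, aeval_monomial]
            apply mul_eq_zero_of_right
            apply Finset.prod_eq_zero (Finsupp.mem_support_iff.2 hni)
            simp [hi, hni]
          rw [this, coeff_zero, coeff_monomial, if_neg]
          rintro rfl
          exact hni (hm i hi)
      | add p q hp hq => rw [map_add, coeff_add, coeff_add, hp, hq]
    rw [← h1, h0, coeff_zero]
  · intro h v hv
    rw [SetLike.mem_coe, mem_coordSub] at hv
    rw [eval_eq']
    apply Finset.sum_eq_zero
    intro m hm
    by_cases hn : ∀ i, i ∉ S → m i = 0
    · rw [h m hn, zero_mul]
    · push Not at hn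
      obtain ⟨i, hi, hni⟩ := hn
      apply mul_eq_zero_of_right
      apply Finset.prod_eq_zero (Finset.mem_univ i)
      rw [hv i hi, zero_pow hni]

lemma mem_sq [Infinite k] (f : MvPolynomial (Fin 4) k) :
    f ∈ (vanIdeal k 4 (coordSub k {0} : Set (Fin 4 → k))) ^ 2 ↔
      ∀ m : Fin 4 →₀ ℕ, m 1 + m 2 + m 3 ≤ 1 → coeff m f = 0 := by
  classical
  rw [sq]
  constructor
  · intro h
    refine Submodule.mul_induction_on h ?_ ?_
    · intro g hg g' hg' m hm
      rw [vanish_coord] at hg hg'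
      rw [coeff_mul]
      apply Finset.sum_eq_zero
      rintro ⟨p, q⟩ hpq
      rw [Finset.HasAntidiagonal.mem_antidiagonal] at hpq
      simp only at hpq
      have e1 := DFunLike.congr_fun hpq 1
      have e2 := DFunLike.congr_fun hpq 2
      have e3 := DFunLike.congr_fun hpq 3
      simp only [Finsupp.add_apply] at e1 e2 e3
      by_cases hp : p 1 + p 2 + p 3 = 0
      · rw [hg p, zero_mul]
        intro i hi
        fin_cases i
        · simp at hi
        · change p 1 = 0; omega
        · change p 2 = 0; omega
        · change p 3 = 0; omega
      · rw [hg' q, mul_zero]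
        intro i hi
        fin_cases i
        · simp at hi
        · change q 1 = 0; omega
        · change q 2 = 0; omega
        · change q 3 = 0; omega
    · intro g g' hg hg' m hm
      rw [coeff_add, hg m hm, hg' m hm, add_zero]
  · intro h
    rw [f.as_sum]
    refine Ideal.sum_mem _ fun m hm => ?_
    have h2 : ¬ (m 1 + m 2 + m 3 ≤ 1) := fun hh => (mem_support_iff.1 hm) (h m hh)
    have hX : ∀ n : Fin 4 →₀ ℕ, n 1 + n 2 + n 3 ≠ 0 → ∀ a : k, monomial n a ∈
        vanIdeal k 4 (coordSub k {0} : Set (Fin 4 → k)) := by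
      intro n hn a
      rw [vanish_coord]
      intro m' hm'
      rw [coeff_monomial, if_neg]
      rintro rfl
      apply hn
      rw [hm' 1 (by simp), hm' 2 (by simp), hm' 3 (by simp)]
    have : ∃ i : Fin 4, i ≠ 0 ∧ m i ≠ 0 := by
      by_contra! hcon
      have := hcon 1 (by simp)
      have := hcon 2 (by simp)
      have := hcon 3 (by simp)
      omega
    obtain ⟨i, hi0, hi⟩ := this
    have hsplit : m = Finsupp.single i 1 + (m - Finsupp.single i 1) := by
      rw [add_tsub_cancel_of_le]
      rw [Finsupp.single_le_iff]
      omega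
    have hmon : monomial m (coeff m f) =
        monomial (Finsupp.single i 1) 1 * monomial (m - Finsupp.single i 1) (coeff m f) := by
      rw [monomial_mul, ← hsplit, one_mul]
    rw [hmon]
    refine Ideal.mul_mem_mul (hX _ ?_ _) (hX _ ?_ _)
    · clear hmon hsplit hm
      fin_cases i
      · exact absurd rfl hi0
      all_goals simp [Finsupp.single_apply]
    · have e1 := DFunLike.congr_fun hsplit 1
      have e2 := DFunLike.congr_fun hsplit 2
      have e3 := DFunLike.congr_fun hsplit 3
      rw [Finsupp.add_apply] at e1 e2 e3
      have : (Finsupp.single i 1 : Fin 4 →₀ ℕ) 1 + (Finsupp.single i 1 : Fin 4 →₀ ℕ) 2 +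
        (Finsupp.single i 1 : Fin 4 →₀ ℕ) 3 ≤ 1 := by
        fin_cases i <;> simp [Finsupp.single_apply]
      omega

lemma coord_inf : coordSub k {0, 1} ⊓ coordSub k {0, 2} = coordSub k {0} := by
  ext v
  rw [Submodule.mem_inf, mem_coordSub, mem_coordSub, mem_coordSub]
  constructor
  · rintro ⟨h1, h2⟩ i hi
    fin_cases i
    · simp at hi
    · exact h2 1 (by simp)
    · exact h1 2 (by simp)
    · exact h1 3 (by simp)
  · intro h
    refine ⟨fun i hi => h i ?_, fun i hi => h i ?_⟩
    · simp at hi ⊢; tauto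
    · simp at hi ⊢; tauto

lemma deg_four (m : Fin 4 →₀ ℕ) : m.degree = m 0 + m 1 + m 2 + m 3 := by
  rw [Finsupp.degree_eq_sum, Fin.sum_univ_four]

lemma sundial_mem [Infinite k] {d : ℕ} (hd : 2 ≤ d) (f : Forms k 4 d) :
    f.1 ∈ vanIdeal k 4 (coordSub k {0, 1} : Set (Fin 4 → k)) ⊓
      vanIdeal k 4 (coordSub k {0, 2} : Set (Fin 4 → k)) ⊓
      (vanIdeal k 4 ((coordSub k {0, 1} ⊓ coordSub k {0, 2} : Submodule k (Fin 4 → k)) :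
        Set (Fin 4 → k))) ^ 2 ↔
      ∀ s, sunFun k d s f = 0 := by
  rw [coord_inf, Submodule.mem_inf, Submodule.mem_inf, mem_sq, vanish_coord, vanish_coord]
  constructor
  · rintro ⟨⟨h1, h2⟩, h3⟩ (_ | (i | i))
    · simp only [sunFun]
      rw [coH_apply]
      apply h3
      simp
    · simp only [sunFun]
      rw [coH_apply]
      apply h1
      intro j hj
      fin_cases j <;> simp_all [conMon]
    · simp only [sunFun]
      rw [coH_apply]
      apply h2
      intro j hj
      fin_cases j <;> simp_all [conMon]
  · intro h
    have hdeg : ∀ m : Fin 4 →₀ ℕ, (m.degree = d → coeff m f.1 = 0) → coeff m f.1 = 0 := by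
      intro m hm
      by_cases hmd : m.degree = d
      · exact hm hmd
      · exact MvPolynomial.IsHomogeneous.coeff_eq_zero f.2 hmd
    have A : ∀ m : Fin 4 →₀ ℕ, m 2 = 0 → m 3 = 0 → coeff m f.1 = 0 := by
      intro m h2 h3
      refine hdeg m fun hm => ?_
      rw [deg_four] at hm
      have := h (some (.inl ⟨m 1, by omega⟩))
      simp only [sunFun] at this
      rw [coH_apply] at this
      convert this using 2
      ext j
      fin_cases j
      · simp [conMon]; omega
      · simp [conMon]
      · simp [conMon, h2]
      · simp [conMon, h3]
    have B : ∀ m : Fin 4 →₀ ℕ, m 1 = 0 → m 3 = 0 → coeff m f.1 = 0 := by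
      intro m h2 h3
      by_cases hz : m 2 = 0
      · exact A m hz h3
      refine hdeg m fun hm => ?_
      rw [deg_four] at hm
      have := h (some (.inr ⟨m 2 - 1, by omega⟩))
      simp only [sunFun] at this
      rw [coH_apply] at this
      convert this using 2
      ext j
      fin_cases j
      · simp [conMon]; omega
      · simp [conMon, h2]
      · simp [conMon]; omega
      · simp [conMon, h3]
    refine ⟨⟨fun m hm => A m (hm 2 (by simp)) (hm 3 (by simp)),
      fun m hm => B m (hm 1 (by simp)) (hm 3 (by simp))⟩, fun m hm => ?_⟩
    by_cases h3 : m 3 = 0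
    · by_cases h2 : m 2 = 0
      · exact A m h2 h3
      · exact B m (by omega) h3
    · refine hdeg m fun hmd => ?_
      rw [deg_four] at hmd
      have := h none
      simp only [sunFun] at this
      rw [coH_apply] at this
      convert this using 2
      ext j
      fin_cases j
      · simp; omega
      · simp; omega
      · simp; omega
      · simp; omega

end Sundial
section Final

variable {k : Type} [Field k]

lemma hdim_eq {d : ℕ} (I : Ideal (MvPolynomial (Fin 4) k)) (W : Submodule k (Forms k 4 d))
    (h : ∀ f : Forms k 4 d, f ∈ W ↔ f.1 ∈ I) : hdim k 4 I d = Module.finrank k W := by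
  have : Submodule.restrictScalars k
        (I : Submodule (MvPolynomial (Fin 4) k) (MvPolynomial (Fin 4) k))
      ⊓ MvPolynomial.homogeneousSubmodule (Fin 4) k d = W.map (Submodule.subtype _) := by
    ext f
    constructor
    · rintro ⟨h1, h2⟩
      exact ⟨⟨f, h2⟩, (h ⟨f, h2⟩).2 h1, rfl⟩
    · rintro ⟨g, hg, rfl⟩
      exact ⟨(h g).1 hg, g.2⟩
  rw [hdim, this, Submodule.finrank_map_subtype_eq]

lemma line_mem {d : ℕ} (u v : Fin 4 → k) {κ : Type} [Fintype κ] (hκ : Fintype.card κ = d + 1)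
    (a b : κ → k) (h : LinearIndependent k (fun i => evH (k := k) d (a i • u + b i • v)))
    (f : Forms k 4 d) :
    f.1 ∈ vanIdeal k 4 (Submodule.span k {u, v} : Set (Fin 4 → k)) ↔
      ∀ i, evH (k := k) d (a i • u + b i • v) f = 0 := by
  constructor
  · intro hf i
    rw [evH_apply]
    exact hf _ (Submodule.mem_span_pair.2 ⟨_, _, rfl⟩)
  · intro hf w hw
    obtain ⟨s, t, rfl⟩ := Submodule.mem_span_pair.1 hw
    exact vanish_on_line u v hκ a b h f (fun i => by rw [← evH_apply]; exact hf i) s t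

lemma eval_smul_form {d : ℕ} (f : Forms k 4 d) (s : k) (p : Fin 4 → k) :
    eval (s • p) f.1 = s ^ d * eval p f.1 := by
  rw [eval_eq', eval_eq', Finset.mul_sum]
  refine Finset.sum_congr rfl fun m hm => ?_
  have hdeg : d = m.degree := f.2.degree_eq_sum_deg_support hm
  have hs : s ^ d = s ^ (m 0 + m 1 + m 2 + m 3) := by rw [← deg_four, ← hdeg]
  rw [hs]
  simp only [Fin.prod_univ_four, Pi.smul_apply, smul_eq_mul]
  ring

lemma point_mem {d : ℕ} (p : Fin 4 → k) (f : Forms k 4 d) :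
    f.1 ∈ vanIdeal k 4 (Submodule.span k {p} : Set (Fin 4 → k)) ↔ evH (k := k) d p f = 0 := by
  rw [evH_apply]
  constructor
  · intro hf
    exact hf _ (Submodule.mem_span_singleton_self p)
  · intro hf w hw
    obtain ⟨s, rfl⟩ := Submodule.mem_span_singleton.1 hw
    have := eval_smul_form f s p
    rw [this, hf]
    simp

/-- The family of all functionals. -/
noncomputable def famF (d : ℕ) {n : ℕ} (u v : Fin n → Fin 4 → k) (a b : Fin n → Option (Fin d) → k) :
    (Option (Fin (d+1) ⊕ Fin d)) ⊕ (Fin n × Option (Fin d)) → Module.Dual k (Forms k 4 d) :=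
  Sum.elim (sunFun k d) (fun io => evH (k := k) d
          (a io.1 io.2 • u io.1 + b io.1 io.2 • v io.1))

lemma famF_mem [Infinite k] {d : ℕ} (hd : 2 ≤ d) {n c : ℕ} (u v : Fin n → Fin 4 → k)
    (a b : Fin n → Option (Fin d) → k) (h : LinearIndependent k (famF d u v a b))
    (p : Fin c → Fin 4 → k) (f : Forms k 4 d) :
    f ∈ (⨅ i, LinearMap.ker (famF d u v a b i)) ⊓ ⨅ l, LinearMap.ker (evH (k := k) d (p l)) ↔
    f.1 ∈ vanIdeal k 4 (coordSub k {0, 1} : Set (Fin 4 → k)) ⊓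
      vanIdeal k 4 (coordSub k {0, 2} : Set (Fin 4 → k)) ⊓
      (vanIdeal k 4 ((coordSub k {0, 1} ⊓ coordSub k {0, 2} : Submodule k (Fin 4 → k)) :
        Set (Fin 4 → k))) ^ 2 ⊓
      (⨅ j, vanIdeal k 4 (Submodule.span k {u j, v j} : Set (Fin 4 → k))) ⊓
      ⨅ l, vanIdeal k 4 (Submodule.span k {p l} : Set (Fin 4 → k)) := by
  rw [Submodule.mem_inf, Submodule.mem_inf, Submodule.mem_inf, sundial_mem hd]
  simp only [Submodule.mem_iInf, point_mem, LinearMap.mem_ker]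
  refine and_congr_left fun _ => ?_
  have hl : ∀ j, f.1 ∈ vanIdeal k 4 (Submodule.span k {u j, v j} : Set (Fin 4 → k)) ↔
      ∀ i, evH (k := k) d (a j i • u j + b j i • v j) f = 0 := by
    intro j
    refine line_mem (u j) (v j) (by simp) (a j) (b j) ?_ f
    exact h.comp (fun o => Sum.inr (j, o)) (by intro x y hxy; simpa using hxy)
  simp only [hl]
  rw [Sum.forall, Prod.forall]
  rfl

lemma main_geom [CharZero k] {d c b bs : ℕ} (hd : 3 ≤ d) (hb : b ≤ bs) (hnum : bs = numL (d-1))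
    (hbig : bs ≤ (d/2) * ((d+1)/2))
    (h1 : c + (2*d+2) + b*(d+1) ≤ (d+3).choose 3)
    (h2 : (d+3).choose 3 ≤ c + (2*d+2) + bs*(d+1)) :
    ∃ (L₁ L₂ : Submodule k (Fin 4 → k))
      (M : Fin bs → Submodule k (Fin 4 → k))
      (P : Fin c → Submodule k (Fin 4 → k)),
      (Module.finrank k L₁ = 2 ∧ Module.finrank k L₂ = 2 ∧ L₁ ≠ L₂ ∧
        Module.finrank k ↥(L₁ ⊓ L₂) = 1) ∧
      (∀ j, Module.finrank k (M j) = 2) ∧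
      (∀ l, Module.finrank k (P l) = 1) ∧
      hdim k 4 (vanIdeal k 4 ↑L₁ ⊓ vanIdeal k 4 ↑L₂ ⊓
          (vanIdeal k 4 ↑(L₁ ⊓ L₂)) ^ 2 ⊓
          (⨅ j : Fin b, vanIdeal k 4 ↑(M (Fin.castLE hb j))) ⊓
          ⨅ l, vanIdeal k 4 ↑(P l)) d + (c + (2*d+2) + b*(d+1)) = (d+3).choose 3 ∧
      hdim k 4 (vanIdeal k 4 ↑L₁ ⊓ vanIdeal k 4 ↑L₂ ⊓
          (vanIdeal k 4 ↑(L₁ ⊓ L₂)) ^ 2 ⊓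
          (⨅ j : Fin bs, vanIdeal k 4 ↑(M j)) ⊓
          ⨅ l, vanIdeal k 4 ↑(P l)) d = 0 := by
  obtain ⟨e, rfl⟩ : ∃ e, d = e + 2 := ⟨d - 2, by omega⟩
  have hl : LinesOK k (e+1) (Fin bs) (Fin (e+2)) := by
    have := lines_all (k := k) (e+1)
    rw [show e + 2 - 1 = e + 1 from rfl] at hnum
    rw [← hnum] at this
    exact this
  obtain ⟨u, v, a, t, huv, hLI⟩ := top_step (k := k) (e := e) (p := (e+2)/2 - 1)
    (r := (e+2+1)/2 - 1) (by omega) (by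
      rw [Fintype.card_fin, Nat.sub_add_cancel (by omega), Nat.sub_add_cancel (by omega)]
      exact hbig) hl
  change LinearIndependent k (famF (e+2) u v a t) at hLI
  let g : Fin b → Fin bs := Fin.castLE hb
  have hg : Function.Injective g := Fin.castLE_injective hb
  let G : (Option (Fin (e+2+1) ⊕ Fin (e+2))) ⊕ (Fin b × Option (Fin (e+2))) →
    (Option (Fin (e+2+1) ⊕ Fin (e+2))) ⊕ (Fin bs × Option (Fin (e+2))) :=
    Sum.map id (Prod.map g id)
  have hG : Function.Injective G :=
    Function.injective_id.sumMap (hg.prodMap Function.injective_id)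
  have hfam : famF (e+2) (u ∘ g) (v ∘ g) (a ∘ g) (t ∘ g) = famF (e+2) u v a t ∘ G := by
    ext1 x
    rcases x with x | x <;> rfl
  have hLI' : LinearIndependent k (famF (e+2) (u ∘ g) (v ∘ g) (a ∘ g) (t ∘ g)) := by
    rw [hfam]
    exact hLI.comp G hG
  have r1 := finrank_common_ker _ hLI
  have r2 := finrank_common_ker _ hLI'
  have hfr : Module.finrank k (Forms k 4 (e+2)) = (e+2+3).choose 3 := by
    rw [finrank_forms, show 4 + (e+2) - 1 = (e+2) + 3 by omega, Nat.choose_symm_add]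
  rw [hfr] at r1 r2
  simp only [Fintype.card_sum, Fintype.card_option, Fintype.card_fin, Fintype.card_prod] at r1 r2
  have hle : (⨅ i, LinearMap.ker (famF (e+2) u v a t i)) ≤
      ⨅ i, LinearMap.ker (famF (e+2) (u ∘ g) (v ∘ g) (a ∘ g) (t ∘ g) i) := by
    rw [hfam]
    exact le_iInf fun i => iInf_le _ (G i)
  have hsep : ∀ f : Forms k 4 (e+2),
      (∀ x : {p : Fin 4 → k // p ≠ 0}, evH (k := k) (e+2) x.1 f = 0) → f = 0 := by
    intro f hf
    apply Subtype.ext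
    apply MvPolynomial.funext
    intro p
    by_cases hp : p = 0
    · have := eval_smul_form f (0 : k) p
      rw [zero_smul, ← hp] at this
      rw [this, zero_pow (by omega), zero_mul, ZeroMemClass.coe_zero, map_zero]
    · have := hf ⟨p, hp⟩
      rw [evH_apply] at this
      simpa using this
  obtain ⟨p, q1, q2⟩ := cut_down (fun x : {p : Fin 4 → k // p ≠ 0} => evH (k := k) (e+2) x.1)
    hsep c _ _ hle (by nlinarith)
  refine ⟨coordSub k {0, 1}, coordSub k {0, 2}, fun j => Submodule.span k {u j, v j},
    fun l => Submodule.span k {(p l).1}, ⟨?_, ?_, ?_, ?_⟩, ?_, ?_, ?_, ?_⟩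
  · exact finrank_coordSub {0, 1} (by simp)
  · exact finrank_coordSub {0, 2} (by simp)
  · intro h
    have : (Pi.single 1 1 : Fin 4 → k) ∈ coordSub k {0, 1} := by
      rw [mem_coordSub]
      intro i hi
      fin_cases i <;> simp_all
    rw [h, mem_coordSub] at this
    simpa using this 1 (by simp)
  · rw [coord_inf]
    exact finrank_coordSub {0} (by simp)
  · intro j
    have := finrank_span_eq_card (huv j)
    rw [Matrix.range_cons_cons_empty] at this
    simpa using this
  · intro l
    exact finrank_span_singleton (p l).2
  · have := hdim_eq _ _
      (famF_mem (by omega) (u ∘ g) (v ∘ g) (a ∘ g) (t ∘ g) hLI' (fun l => (p l).1))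
    simp only [Function.comp, g] at this
    simp only [this]
    simp only [Function.comp, g] at q2 r2
    nlinarith
  · simp only []
    rw [hdim_eq _ _ (famF_mem (by omega) u v a t hLI (fun l => (p l).1)), q1]
    have : Module.finrank k ↥(⨅ i, LinearMap.ker (famF (e+2) u v a t i)) ≤ c := by nlinarith
    omega

end Final
section Arith

lemma arith24 (d : ℕ) (hmod : Odd d ∨ d % 8 = 6) : ∃ q, (d+1)*(d+2)*(d+3) = 24 * q := by
  have h3 : 3 ∣ (d+1)*(d+2)*(d+3) := by
    have : d % 3 = 0 ∨ d % 3 = 1 ∨ d % 3 = 2 := by omega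
    rcases this with h | h | h
    · exact Dvd.dvd.mul_left (by omega) _
    · exact Dvd.dvd.mul_right (Dvd.dvd.mul_left (by omega) _) _
    · exact Dvd.dvd.mul_right (Dvd.dvd.mul_right (by omega) _) _
  have h8 : 8 ∣ (d+1)*(d+2)*(d+3) := by
    rcases hmod with ⟨t, rfl⟩ | h
    · have : t % 2 = 0 ∨ t % 2 = 1 := by omega
      rcases this with h | h
      · obtain ⟨s, rfl⟩ : ∃ s, t = 2 * s := ⟨t/2, by omega⟩
        exact ⟨(2*s+1)*(4*s+3)*(s+1), by ring⟩
      · obtain ⟨s, rfl⟩ : ∃ s, t = 2 * s + 1 := ⟨t/2, by omega⟩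
        exact ⟨(s+1)*(4*s+5)*(2*s+3), by ring⟩
    · exact Dvd.dvd.mul_right (Dvd.dvd.mul_left (by omega) _) _
  have : 24 ∣ (d+1)*(d+2)*(d+3) := by omega
  exact this

lemma ch3 (n : ℕ) : (n+3).choose 3 * 6 = (n+1)*(n+2)*(n+3) := by
  have := Nat.descFactorial_eq_factorial_mul_choose (n+3) 3
  simp [Nat.descFactorial, Nat.factorial] at this
  rw [mul_comm, ← this]
  ring

lemma ch4 (n : ℕ) : (n+4).choose 4 * 24 = (n+1)*(n+2)*(n+3)*(n+4) := by
  have := Nat.descFactorial_eq_factorial_mul_choose (n+4) 4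
  simp [Nat.descFactorial, Nat.factorial] at this
  rw [mul_comm, ← this]
  ring

lemma arith_big (d : ℕ) (hd : 3 ≤ d) :
    ((d+2)*(d+3)+7)/8 - 2 ≤ (d/2) * ((d+1)/2) := by
  by_cases h : d ≤ 4
  · interval_cases d <;> norm_num
  · obtain ⟨t, rfl | rfl⟩ : ∃ t, d = 2*t ∨ d = 2*t+1 := ⟨d/2, by omega⟩
    · rw [show 2*t/2 = t by omega, show (2*t+1)/2 = t by omega]
      have : (2*t+2)*(2*t+3)+7 < 8 * (t*t+3) := by nlinarith
      omega
    · rw [show (2*t+1)/2 = t by omega, show (2*t+1+1)/2 = t+1 by omega]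
      have : (2*t+1+2)*(2*t+1+3)+7 < 8 * (t*(t+1)+3) := by nlinarith
      omega

lemma arith_x (d b c T : ℤ) (hd : 3 ≤ d) (hT : T * 6 = (d-1)*d*(d+1))
    (hq : (d+1)*(d+2)*(d+3) = 24 * c) (g1 : 8 * (b+2) ≤ (d+2)*(d+3))
    (g2 : (d+2)*(d+3) < 8 * (b+2) + 8) : 0 ≤ T - b * (d-1) ∧ T - b * (d-1) < c := by
  have h56 : 0 ≤ (d-5)*(d-6) := by
    by_cases h : d ≤ 5
    · nlinarith
    · exact mul_nonneg (by omega) (by omega)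
  have hlow : 0 ≤ d*(d+1) - 6 * b := by linarith
  have hup : 0 ≤ 24 * b - 3 * ((d+2)*(d+3)) + 69 := by linarith
  have A := mul_nonneg (by omega : 0 ≤ d - 1) hlow
  have B := mul_nonneg (by omega : 0 ≤ d - 1) hup
  constructor
  · linarith
  · have : 0 ≤ (d-3)*(d-3) := mul_self_nonneg _
    nlinarith

end Arith

set_option maxHeartbeats 1000000

/-- Lemma 4.3 of the paper: for `d ≥ 3` odd or `d ≡ 6 (mod 8)`, a sundial
(degenerate conic with an embedded point), `b` (resp. `b*`) generic lines and `c`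
generic points in `ℙ^3` impose independent conditions on forms of degree `d`. -/
theorem stmt10 (k : Type) [Field k] [IsAlgClosed k] [CharZero k]
    (d : ℕ) (hd : 3 ≤ d) (hmod : Odd d ∨ d % 8 = 6)
    (c b bs : ℕ) (hc : c = (d+3).choose 4 / d)
    (hb : b = (d+4).choose 4 / (d+1) - (c + 2))
    (hbs : bs = ((d+4).choose 4 + d) / (d+1) - (c + 2)) :
    (d ∣ (d+3).choose 4) ∧
    (c + 2 < (d+4).choose 4 / (d+1)) ∧
    (0 ≤ ((d+1).choose 3 : ℤ) - b * ((d : ℤ) - 1) ∧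
      ((d+1).choose 3 : ℤ) - b * ((d : ℤ) - 1) < c) ∧
    ∃ (L₁ L₂ : Submodule k (Fin 4 → k))
      (M : Fin (max b bs) → Submodule k (Fin 4 → k))
      (P : Fin c → Submodule k (Fin 4 → k)),
      (Module.finrank k L₁ = 2 ∧ Module.finrank k L₂ = 2 ∧ L₁ ≠ L₂ ∧
        Module.finrank k ↥(L₁ ⊓ L₂) = 1) ∧
      (∀ j, Module.finrank k (M j) = 2) ∧
      (∀ l, Module.finrank k (P l) = 1) ∧
      (hdim k 4 (vanIdeal k 4 ↑L₁ ⊓ vanIdeal k 4 ↑L₂ ⊓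
          (vanIdeal k 4 ↑(L₁ ⊓ L₂)) ^ 2 ⊓
          (⨅ j : Fin b, vanIdeal k 4 ↑(M (Fin.castLE (le_max_left b bs) j))) ⊓
          ⨅ l, vanIdeal k 4 ↑(P l)) d : ℤ)
        = ((d+3).choose 3 : ℤ) - (2*d+2) - b * (d+1) - c ∧
      hdim k 4 (vanIdeal k 4 ↑L₁ ⊓ vanIdeal k 4 ↑L₂ ⊓
          (vanIdeal k 4 ↑(L₁ ⊓ L₂)) ^ 2 ⊓
          (⨅ j : Fin bs, vanIdeal k 4 ↑(M (Fin.castLE (le_max_right b bs) j))) ⊓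
          ⨅ l, vanIdeal k 4 ↑(P l)) d = 0 := by
  obtain ⟨q, hq⟩ := arith24 d hmod
  have c3 : (d+3).choose 3 = 4 * q := by
    have := ch3 d
    omega
  have c4 : (d+4).choose 4 = q * (d+4) := by
    have := ch4 d
    rw [hq] at this
    nlinarith
  have c4' : (d+3).choose 4 = d * q := by
    obtain ⟨n, rfl⟩ : ∃ n, d = n + 1 := ⟨d - 1, by omega⟩
    have := ch4 n
    rw [show n + 1 + 3 = n + 4 from rfl]
    nlinarith
  have c1 : (d+1).choose 3 * 6 = (d-1)*d*(d+1) := by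
    obtain ⟨n, rfl⟩ : ∃ n, d = n + 2 := ⟨d - 2, by omega⟩
    have := ch3 n
    rw [show n + 2 + 1 = n + 3 from rfl, this]
    simp
  have hcq : c = q := by
    rw [hc, c4', Nat.mul_div_cancel_left _ (by omega)]
  clear hc
  subst hcq
  obtain ⟨X, hX⟩ : ∃ X, X = (d+2)*(d+3) := ⟨_, rfl⟩
  have hXq : (d+1) * X = 24 * c := by rw [hX, ← hq]; ring
  have hX30 : 30 ≤ X := by rw [hX]; nlinarith
  have f1 : (d+4).choose 4 / (d+1) = c + X/8 := by
    rw [c4]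
    have h1 : 8 * (X/8) ≤ X := by omega
    have h2 : X < 8 * (X/8) + 8 := by omega
    generalize X/8 = m at *
    apply Nat.div_eq_of_lt_le <;> nlinarith
  have f2 : ((d+4).choose 4 + d) / (d+1) = c + (X+7)/8 := by
    rw [c4]
    have h1 : 8 * ((X+7)/8) ≤ X+7 := by omega
    have h2 : X ≤ 8 * ((X+7)/8) := by omega
    generalize (X+7)/8 = m at *
    apply Nat.div_eq_of_lt_le <;> nlinarith
  rw [f1] at hb ⊢
  rw [f2] at hbs
  have hbX : b + 2 = X/8 := by omega
  have hbsX : bs + 2 = (X+7)/8 := by omega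
  have hle : b ≤ bs := by omega
  have g1 : 8 * (b+2) ≤ X := by omega
  have g2 : X < 8 * (b+2) + 8 := by omega
  have g3 : X ≤ 8 * (bs+2) := by omega
  have k1 : (d+1) * (8 * (b+2)) ≤ (d+1) * X := Nat.mul_le_mul_left _ g1
  have k3 : (d+1) * X ≤ (d+1) * (8 * (bs+2)) := Nat.mul_le_mul_left _ g3
  refine ⟨⟨c, c4'⟩, by omega, ?_, ?_⟩
  · obtain ⟨n, rfl⟩ : ∃ n, d = n + 3 := ⟨d - 3, by omega⟩
    rw [show n + 3 - 1 = n + 2 from rfl] at c1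
    zify at c1 g1 g2 hX hq ⊢
    rw [hX] at g1 g2
    have := arith_x (n+3) b c ((n+3+1).choose 3) (by omega) (by rw [c1]; ring) hq g1 g2
    exact this
  · obtain ⟨L₁, L₂, M, P, hL, hM, hP, e1, e2⟩ := main_geom (k := k) (d := d) (c := c) (b := b)
      (bs := bs) hd hle
      (by
        obtain ⟨n, rfl⟩ : ∃ n, d = n + 1 := ⟨d - 1, by omega⟩
        rw [show n + 1 - 1 = n from rfl, numL]
        rw [show (n+3)*(n+4) = X from hX.symm]
        omega)
      (by
        have := arith_big d hd
        rw [← hX] at this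
        omega)
      (by rw [c3]; linarith) (by rw [c3]; linarith)
    refine ⟨L₁, L₂, fun j => M (Fin.cast (max_eq_right hle) j), P, hL, fun j => hM _, hP, ?_, ?_⟩
    · have e1' : (hdim k 4 (vanIdeal k 4 ↑L₁ ⊓ vanIdeal k 4 ↑L₂ ⊓
          (vanIdeal k 4 ↑(L₁ ⊓ L₂)) ^ 2 ⊓
          (⨅ j : Fin b, vanIdeal k 4 ↑(M (Fin.castLE hle j))) ⊓
          ⨅ l, vanIdeal k 4 ↑(P l)) d : ℤ)
        = ((d+3).choose 3 : ℤ) - (2*d+2) - b * (d+1) - c := by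
        rw [← e1]
        push_cast
        ring
      exact e1'
    · exact e2
end

section
/- Let k be an algebraically closed field of characteristic zero, n ≥ 3, d ≥ 1, and let a, b, c ∈ ℕ with a + b ≤ d − 1. Set t = ⌊C(d+n,n)/(d+1)⌋ and assume c ≤ t − 2(a+b). Suppose statement S(n,d) holds, i.e., there exist in P^n sundials Ĉ_1,…,Ĉ_{d−1} and lines M_1,…,M_{t−2(d−1)} whose combined ideal I satisfies dim (I)_d = C(d+n,n) − t(d+1). Then there exist in P^n sundials Ĉ_1,…,Ĉ_a, degenerate conics D_1,…,D_b, points R_1,…,R_b, and lines M_1,…,M_c whose combined ideal I' satisfies dim (I')_d = C(d+n,n) − (2a + 2b + c)(d+1). -/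
open MvPolynomial

/-- A 3-dimensional sundial: two distinct lines `V₁ ≠ V₂` meeting in a point
`P = V₁ ⊓ V₂`, together with a 4-dimensional subspace `T ⊇ V₁ ⊔ V₂`. -/
def IsSundial (k : Type) [Field k] (N : ℕ)
    (V₁ V₂ T : Submodule k (Fin N → k)) : Prop :=
  Module.finrank k V₁ = 2 ∧ Module.finrank k V₂ = 2 ∧ V₁ ≠ V₂ ∧
    Module.finrank k ↥(V₁ ⊓ V₂) = 1 ∧ V₁ ⊔ V₂ ≤ T ∧ Module.finrank k T = 4

/-- The ideal `I(V₁) ∩ I(V₂) ∩ (I(P)² + I(T))` of a 3-dimensional sundial. -/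
noncomputable def sundialIdeal (k : Type) [Field k] (N : ℕ)
    (V₁ V₂ T : Submodule k (Fin N → k)) : Ideal (MvPolynomial (Fin N) k) :=
  vanIdeal k N ↑V₁ ⊓ vanIdeal k N ↑V₂ ⊓
    ((vanIdeal k N ↑(V₁ ⊓ V₂)) ^ 2 + vanIdeal k N ↑T)

theorem finrank_homog {k : Type} [Field k] (n d : ℕ) :
    Module.finrank k (MvPolynomial.homogeneousSubmodule (Fin (n+1)) k d) = (d+n).choose n := by
  rw [homogeneousSubmodule_eq_finsupp_supported]
  have e := AddMonoidAlgebra.supportedEquivFinsupp (R := k) (S := k)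
    {m : Fin (n+1) →₀ ℕ | m.degree = d}
  have hs : {m : Fin (n+1) →₀ ℕ | m.degree = d}
      = ↑(Finset.finsuppAntidiag (Finset.univ : Finset (Fin (n+1))) d) := by
    ext m
    simp [Finset.mem_finsuppAntidiag, Finsupp.degree_eq_sum]
  have h1 := LinearEquiv.finrank_eq e
  rw [h1]
  rw [hs]
  rw [Module.finrank_finsupp_self]
  simp only [Finset.coe_sort_coe, Fintype.card_coe]
  rw [Finset.card_finsuppAntidiag_nat_eq_choose]
  simp only [Finset.card_univ, Fintype.card_fin]
  rw [show n + 1 + d - 1 = d + n by omega, Nat.choose_symm_add]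


section helpers

variable {k : Type} [Field k]

theorem homog_finite (N d : ℕ) :
    Module.Finite k (MvPolynomial.homogeneousSubmodule (Fin N) k d) :=
  Module.Finite.iff_fg.mpr (MvPolynomial.homogeneousSubmodule_fg _ _ d)

/-- general Taylor -/
theorem taylor_mem {N : ℕ} {A : Type} [CommRing A] [Algebra k A] (J : Ideal A)
    (x y : Fin N → A) (hy : ∀ i, y i ∈ J) (f : MvPolynomial (Fin N) k) :
    aeval (fun i => x i + y i) f - aeval x f - ∑ i, aeval x (pderiv i f) * y i ∈ J ^ 2 := by
  induction f using MvPolynomial.induction_on with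
  | C a => simp
  | add p q hp hq =>
    have := Ideal.add_mem _ hp hq
    convert! this using 1
    simp only [map_add, add_mul, Finset.sum_add_distrib]
    ring
  | mul_X p j hp =>
    have e1 : ∑ i, aeval x (pderiv i (p * X j)) * y i
        = (∑ i, aeval x (pderiv i p) * y i) * x j + aeval x p * y j := by
      simp only [Derivation.leibniz, smul_eq_mul, pderiv_X, map_add, map_mul, aeval_X, add_mul,
        Finset.sum_add_distrib, Finset.sum_mul]
      rw [add_comm]
      congr 1
      · exact Finset.sum_congr rfl fun i _ => by ring
      · rw [Finset.sum_eq_single j]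
        · simp
        · intro b _ hb
          simp [hb.symm]
        · simp
    have e2 : (∑ i, aeval x (pderiv i p) * y i) * y j ∈ J ^ 2 := by
      rw [pow_two]
      exact Ideal.mul_mem_mul (Ideal.sum_mem _ fun i _ => Ideal.mul_mem_left _ _ (hy i)) (hy j)
    have := Ideal.add_mem _ (Ideal.mul_mem_right (x j + y j) _ hp) e2
    convert! this using 1
    rw [e1]
    simp only [map_mul, aeval_X]
    ring

theorem aeval_smul_homog {N d : ℕ} {A : Type} [CommRing A] [Algebra k A] (c : A) (x : Fin N → A)
    {f : MvPolynomial (Fin N) k} (hf : f.IsHomogeneous d) :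
    aeval (fun i => c * x i) f = c ^ d * aeval x f := by
  rw [aeval_def, aeval_def, eval₂_eq, eval₂_eq, Finset.mul_sum]
  refine Finset.sum_congr rfl fun m hm => ?_
  have := hf.degree_eq_sum_deg_support hm
  simp only [mul_pow, Finset.prod_mul_distrib, Finset.prod_pow_eq_pow_sum]
  rw [show ∑ i ∈ m.support, m i = d from this.symm]
  ring

theorem eval_smul_homog {N d : ℕ} (c : k) (x : Fin N → k)
    {f : MvPolynomial (Fin N) k} (hf : f.IsHomogeneous d) :
    eval (c • x) f = c ^ d * eval x f := by
  have := aeval_smul_homog c x hf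
  rw [MvPolynomial.aeval_eq_eval] at this
  exact this

noncomputable def linp {N : ℕ} (p u : Fin N → k) : MvPolynomial (Fin N) k →ₐ[k] Polynomial k :=
  aeval (fun i => Polynomial.C (p i) + Polynomial.X * Polynomial.C (u i))

theorem eval_linp {N : ℕ} (p u : Fin N → k) (s : k) (f : MvPolynomial (Fin N) k) :
    (linp p u f).eval s = eval (p + s • u) f := by
  have : ((Polynomial.aeval s).comp (linp p u)) = MvPolynomial.aeval (p + s • u) := by
    apply MvPolynomial.algHom_ext
    intro i
    simp [linp]
    ring
  have h := DFunLike.congr_fun this f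
  simpa [MvPolynomial.aeval_eq_eval, Polynomial.aeval_def, Polynomial.eval₂_eq_eval_map] using h

theorem linp_natDegree {N d : ℕ} (p u : Fin N → k)
    {f : MvPolynomial (Fin N) k} (hf : f.IsHomogeneous d) :
    (linp p u f).natDegree ≤ d := by
  have := MvPolynomial.aeval_natDegree_le (m := d) (n := 1) f hf.totalDegree_le
    (fun i => Polynomial.C (p i) + Polynomial.X * Polynomial.C (u i)) (by
      intro i
      compute_degree)
  simpa [linp] using this

/-- coefficients vanish iff vanishes on the span -/
theorem linp_zero_iff [Infinite k] {N d : ℕ} (p u : Fin N → k)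
    {f : MvPolynomial (Fin N) k} (hf : f.IsHomogeneous d) :
    linp p u f = 0 ↔ ∀ v ∈ Submodule.span k {p, u}, eval v f = 0 := by
  constructor
  · intro h v hv
    obtain ⟨a, b, rfl⟩ := Submodule.mem_span_pair.mp hv
    have key : ∀ a' : k, a' ≠ 0 → (linp (b • u) p f).eval a' = 0 := by
      intro a' ha'
      rw [eval_linp]
      have : b • u + a' • p = a' • (p + (b / a') • u) := by
        rw [smul_add, smul_smul, mul_div_cancel₀ _ ha', add_comm]
      rw [this, eval_smul_homog _ _ hf, ← eval_linp, h]
      simp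
    have hz : linp (b • u) p f = 0 := by
      have : Polynomial.X * linp (b • u) p f = 0 := by
        apply Polynomial.funext
        intro r
        by_cases hr : r = 0
        · simp [hr]
        · simp [key r hr]
      simpa using this
    rw [add_comm, ← eval_linp, hz]
    simp
  · intro h
    apply Polynomial.funext
    intro r
    rw [eval_linp, Polynomial.eval_zero]
    exact h _ (Submodule.mem_span_pair.mpr ⟨1, r, by simp⟩)

theorem linp_eq_zero_of_coeff {N d : ℕ} (p u : Fin N → k)
    {f : MvPolynomial (Fin N) k} (hf : f.IsHomogeneous d)
    (h : ∀ j ≤ d, (linp p u f).coeff j = 0) : linp p u f = 0 := by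
  ext j
  rw [Polynomial.coeff_zero]
  by_cases hj : j ≤ d
  · exact h j hj
  · exact Polynomial.coeff_eq_zero_of_natDegree_lt
      (lt_of_le_of_lt (linp_natDegree p u hf) (not_le.mp hj))

theorem linp_coeff_zero {N : ℕ} (p u : Fin N → k) (f : MvPolynomial (Fin N) k) :
    (linp p u f).coeff 0 = eval p f := by
  rw [Polynomial.coeff_zero_eq_eval_zero, eval_linp]
  simp

theorem linp_coeff_one {N : ℕ} (p u : Fin N → k) (f : MvPolynomial (Fin N) k) :
    (linp p u f).coeff 1 = ∑ i, eval p (pderiv i f) * u i := by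
  have h := taylor_mem (Ideal.span {(Polynomial.X : Polynomial k)})
    (fun i => Polynomial.C (p i)) (fun i => Polynomial.X * Polynomial.C (u i))
    (fun i => Ideal.mul_mem_right _ _ (Ideal.mem_span_singleton_self _)) f
  rw [Ideal.span_singleton_pow, Ideal.mem_span_singleton, Polynomial.X_pow_dvd_iff] at h
  have h1 := h 1 (by norm_num)
  have hc : ∀ g : MvPolynomial (Fin N) k,
      aeval (fun i => Polynomial.C (p i)) g = Polynomial.C (eval p g) := by
    intro g
    have := MvPolynomial.aeval_algebraMap_apply (Polynomial k) p g
    rw [MvPolynomial.aeval_eq_eval] at this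
    exact this
  simp only [hc, Polynomial.coeff_sub, Polynomial.finsetSum_coeff] at h1
  simp only [Polynomial.coeff_C_mul, Polynomial.coeff_X_mul, Polynomial.coeff_C_zero] at h1
  rw [Polynomial.coeff_C_of_ne_zero (by norm_num), sub_zero, sub_eq_zero] at h1
  exact h1

end helpers

section helpers2

variable {k : Type} [Field k]

theorem finrank_le_of_functionals {V ι : Type} [AddCommGroup V] [Module k V] [Fintype ι]
    (L L' : Submodule k V) [Module.Finite k L] [Module.Finite k L'] (φ : V →ₗ[k] (ι → k))
    (h : ∀ f ∈ L, φ f = 0 → f ∈ L') :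
    Module.finrank k L ≤ Module.finrank k L' + Fintype.card ι := by
  have h1 := LinearMap.finrank_range_add_finrank_ker (φ.domRestrict L)
  have h2 : Module.finrank k (LinearMap.range (φ.domRestrict L)) ≤ Fintype.card ι := by
    have := Submodule.finrank_le (LinearMap.range (φ.domRestrict L))
    simpa using this
  have h3 : Module.finrank k (LinearMap.ker (φ.domRestrict L)) ≤ Module.finrank k L' := by
    let g : LinearMap.ker (φ.domRestrict L) →ₗ[k] L' :=
      (L.subtype ∘ₗ (LinearMap.ker (φ.domRestrict L)).subtype).codRestrict L' (by
        rintro ⟨⟨f, hf⟩, hk⟩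
        exact h f hf hk)
    apply LinearMap.finrank_le_finrank_of_injective (f := g)
    rintro ⟨⟨f, hf⟩, hk⟩ ⟨⟨f', hf'⟩, hk'⟩ heq
    have := congrArg Subtype.val heq
    simpa [g] using this
  omega

theorem semicont [Infinite k] {V ι : Type} [AddCommGroup V] [Module k V] [Fintype ι]
    [DecidableEq ι]
    (L L0 : Submodule k V) [Module.Finite k L] [Module.Finite k L0]
    (φ : k → V →ₗ[k] (ι → k)) (Q : V → ι → Polynomial k)
    (hQ : ∀ s f i, (Q f i).eval s = φ s f i)
    (h0 : ∀ f ∈ L, φ 0 f = 0 → f ∈ L0)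
    (hdimL : Module.finrank k L0 + Fintype.card ι ≤ Module.finrank k L) :
    ∃ s : k, s ≠ 0 ∧ ∀ L' : Submodule k V, L' ≤ L → (∀ f ∈ L', φ s f = 0) →
      Module.finrank k L' + Fintype.card ι ≤ Module.finrank k L := by
  have h1 := LinearMap.finrank_range_add_finrank_ker ((φ 0).domRestrict L)
  have h3 : Module.finrank k (LinearMap.ker ((φ 0).domRestrict L)) ≤ Module.finrank k L0 := by
    let g : LinearMap.ker ((φ 0).domRestrict L) →ₗ[k] L0 :=
      (L.subtype ∘ₗ (LinearMap.ker ((φ 0).domRestrict L)).subtype).codRestrict L0 (by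
        rintro ⟨⟨f, hf⟩, hk⟩
        exact h0 f hf hk)
    apply LinearMap.finrank_le_finrank_of_injective (f := g)
    rintro ⟨⟨f, hf⟩, hk⟩ ⟨⟨f', hf'⟩, hk'⟩ heq
    have := congrArg Subtype.val heq
    simpa [g] using this
  have hr : LinearMap.range ((φ 0).domRestrict L) = ⊤ := by
    apply Submodule.eq_top_of_finrank_eq
    apply le_antisymm (Submodule.finrank_le _)
    simp only [Module.finrank_pi]
    omega
  have hsurj := LinearMap.range_eq_top.mp hr
  choose x hx using fun j : ι => hsurj (Pi.single j 1)
  let M : Matrix ι ι (Polynomial k) := Matrix.of fun j i => Q (x j) i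
  have hM : ∀ s, M.det.eval s = Matrix.det (Matrix.of fun j i => φ s (x j) i) := by
    intro s
    rw [← Polynomial.coe_evalRingHom, RingHom.map_det]
    congr 1
    ext j i
    simp [M, hQ]
  have hM0 : M.det.eval 0 = 1 := by
    rw [hM]
    have : (Matrix.of fun j i => φ 0 (x j) i) = (1 : Matrix ι ι k) := by
      ext j i
      have := congrFun (hx j) i
      simp only [LinearMap.domRestrict_apply] at this
      rw [Matrix.of_apply, this, Matrix.one_apply, Pi.single_apply]
      simp [eq_comm]
    rw [this, Matrix.det_one]
  have hne : Polynomial.X * M.det ≠ 0 := by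
    intro h
    rcases mul_eq_zero.mp h with h | h
    · exact Polynomial.X_ne_zero h
    · rw [h] at hM0
      simp at hM0
  obtain ⟨s, hs⟩ : ∃ s, (Polynomial.X * M.det).eval s ≠ 0 := by
    by_contra! hcon
    exact hne (Polynomial.funext fun r => by simpa using hcon r)
  rw [Polynomial.eval_mul, Polynomial.eval_X] at hs
  refine ⟨s, left_ne_zero_of_mul hs, ?_⟩
  intro L' hL' hker
  have hdet := right_ne_zero_of_mul hs
  rw [hM] at hdet
  have hli : LinearIndependent k (fun j => φ s (x j)) :=
    Matrix.linearIndependent_rows_of_det_ne_zero (A := Matrix.of fun j i => φ s (x j) i) hdet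
  have hfr : Fintype.card ι ≤ Module.finrank k (LinearMap.range ((φ s).domRestrict L)) := by
    have hli' : LinearIndependent k
        (fun j => (⟨φ s (x j), ⟨x j, rfl⟩⟩ : LinearMap.range ((φ s).domRestrict L))) :=
      LinearIndependent.of_comp (Submodule.subtype _) hli
    exact hli'.fintype_card_le_finrank
  have h1' := LinearMap.finrank_range_add_finrank_ker ((φ s).domRestrict L)
  have h4 : Module.finrank k L' ≤ Module.finrank k (LinearMap.ker ((φ s).domRestrict L)) := by
    let g : L' →ₗ[k] LinearMap.ker ((φ s).domRestrict L) :=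
      (Submodule.inclusion hL').codRestrict _ (by
        rintro ⟨f, hf⟩
        exact hker f hf)
    apply LinearMap.finrank_le_finrank_of_injective (f := g)
    rintro ⟨f, hf⟩ ⟨f', hf'⟩ heq
    have := congrArg (fun z => z.val.val) heq
    simpa [g] using this
  omega

noncomputable def lin2 {N : ℕ} (p w v : Fin N → k) :
    MvPolynomial (Fin N) k →ₐ[k] Polynomial (Polynomial k) :=
  aeval (fun i => Polynomial.C (Polynomial.C (p i) + Polynomial.X * Polynomial.C (w i)) +
    Polynomial.X * Polynomial.C (Polynomial.C (v i)))

theorem eval_coeff_lin2 {N : ℕ} (p w v : Fin N → k) (s : k) (f : MvPolynomial (Fin N) k) (j : ℕ) :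
    ((lin2 p w v f).coeff j).eval s = (linp (p + s • w) v f).coeff j := by
  have : ((Polynomial.mapAlgHom (Polynomial.aeval s)).comp (lin2 p w v)) = linp (p + s • w) v := by
    apply MvPolynomial.algHom_ext
    intro i
    simp [linp, lin2]
    ring
  rw [← this]
  simp [Polynomial.coeff_map]

noncomputable def phi {N : ℕ} (d : ℕ) (p u v w : Fin N → k) (s : k) :
    MvPolynomial (Fin N) k →ₗ[k] ((Fin (d+1) ⊕ Fin d) ⊕ Unit → k) where
  toFun f := Sum.elim (Sum.elim (fun j => (linp p u f).coeff j)
    (fun j => (linp (p + s • w) v f).coeff (j + 1))) (fun _ => (linp p w f).divX.eval s)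
  map_add' f g := by
    ext i
    rcases i with (i | i) | i <;> simp [Polynomial.divX_add]
  map_smul' c f := by
    ext i
    rcases i with (i | i) | i <;> simp [Polynomial.smul_eq_C_mul, Polynomial.divX_C_mul]

noncomputable def phiQ {N : ℕ} (d : ℕ) (p u v w : Fin N → k)
    (f : MvPolynomial (Fin N) k) : (Fin (d+1) ⊕ Fin d) ⊕ Unit → Polynomial k :=
  Sum.elim (Sum.elim (fun j => Polynomial.C ((linp p u f).coeff j))
    (fun j => (lin2 p w v f).coeff (j + 1))) (fun _ => (linp p w f).divX)

theorem phiQ_eval {N : ℕ} (d : ℕ) (p u v w : Fin N → k) (s : k) (f : MvPolynomial (Fin N) k)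
    (i : (Fin (d+1) ⊕ Fin d) ⊕ Unit) :
    (phiQ d p u v w f i).eval s = phi d p u v w s f i := by
  rcases i with (i | i) | i <;> simp [phi, phiQ, eval_coeff_lin2]

/-- conic part of functionals -/
noncomputable def psi {N : ℕ} (d : ℕ) (p u v : Fin N → k) :
    MvPolynomial (Fin N) k →ₗ[k] (Fin (d+1) ⊕ Fin d → k) where
  toFun f := Sum.elim (fun j => (linp p u f).coeff j) (fun j => (linp p v f).coeff (j + 1))
  map_add' f g := by
    ext i
    rcases i with i | i <;> simp
  map_smul' c f := by
    ext i
    rcases i with i | i <;> simp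

theorem psi_zero [Infinite k] {N d : ℕ} (p u v : Fin N → k)
    {f : MvPolynomial (Fin N) k} (hf : f.IsHomogeneous d) (h : psi d p u v f = 0) :
    (∀ x ∈ Submodule.span k {p, u}, eval x f = 0) ∧
      (∀ x ∈ Submodule.span k {p, v}, eval x f = 0) := by
  have h1 : linp p u f = 0 := by
    apply linp_eq_zero_of_coeff p u hf
    intro j hj
    exact congrFun h (Sum.inl ⟨j, by omega⟩)
  have h2 : linp p v f = 0 := by
    apply linp_eq_zero_of_coeff p v hf
    intro j hj
    rcases j with _ | j
    · rw [linp_coeff_zero, ← linp_coeff_zero p u, h1]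
      simp
    · exact congrFun h (Sum.inr ⟨j, by omega⟩)
  exact ⟨(linp_zero_iff p u hf).mp h1, (linp_zero_iff p v hf).mp h2⟩

theorem phi_zero [Infinite k] {N d : ℕ} (p u v w : Fin N → k)
    {f : MvPolynomial (Fin N) k} (hf : f.IsHomogeneous d) (h : phi d p u v w 0 f = 0) :
    (∀ x ∈ Submodule.span k {p, u}, eval x f = 0) ∧
      (∀ x ∈ Submodule.span k {p, v}, eval x f = 0) ∧ (linp p w f).coeff 1 = 0 := by
  have h1 : psi d p u v f = 0 := by
    ext i
    have := congrFun h (Sum.inl i)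
    rcases i with i | i <;> simpa [phi, psi] using this
  refine ⟨(psi_zero p u v hf h1).1, (psi_zero p u v hf h1).2, ?_⟩
  have := congrFun h (Sum.inr ())
  simpa [phi, ← Polynomial.coeff_zero_eq_eval_zero, Polynomial.coeff_divX] using this

theorem phi_of_vanish [Infinite k] {N d : ℕ} (p u v w : Fin N → k) (s : k) (hs : s ≠ 0)
    {f : MvPolynomial (Fin N) k} (hf : f.IsHomogeneous d)
    (h1 : ∀ x ∈ Submodule.span k {p, u}, eval x f = 0)
    (h2 : ∀ x ∈ Submodule.span k {p + s • w, v}, eval x f = 0) :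
    phi d p u v w s f = 0 := by
  ext i
  rcases i with (i | i) | i
  · simp [phi, (linp_zero_iff p u hf).mpr h1]
  · simp [phi, (linp_zero_iff _ _ hf).mpr h2]
  · have e := congrArg (Polynomial.eval s) (Polynomial.X_mul_divX_add (linp p w f))
    rw [eval_linp, h2 _ (Submodule.subset_span (by simp)), linp_coeff_zero,
      h1 _ (Submodule.subset_span (by simp))] at e
    simp only [map_zero, add_zero, Polynomial.eval_mul, Polynomial.eval_X, mul_eq_zero] at e
    simpa [phi] using e.resolve_left hs

theorem mem_sundial [Infinite k] {N d : ℕ} (V₁ V₂ T : Submodule k (Fin N → k))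
    (p w : Fin N → k) (hp : p ≠ 0) (hP : V₁ ⊓ V₂ = Submodule.span k {p})
    (hT : T = V₁ ⊔ V₂ ⊔ Submodule.span k {w})
    {f : MvPolynomial (Fin N) k} (hf : f.IsHomogeneous d)
    (h1 : ∀ x ∈ V₁, eval x f = 0) (h2 : ∀ x ∈ V₂, eval x f = 0)
    (h3 : (linp p w f).coeff 1 = 0) : f ∈ sundialIdeal k N V₁ V₂ T := by
  refine ⟨⟨h1, h2⟩, ?_⟩
  have hpm : p ∈ V₁ ⊓ V₂ := hP ▸ Submodule.mem_span_singleton_self p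
  let D : (Fin N → k) →ₗ[k] k := ∑ i, (eval p (pderiv i f)) • LinearMap.proj i
  have hD : ∀ z, D z = (linp p z f).coeff 1 := by
    intro z
    rw [linp_coeff_one]
    simp [D]
  have hsub : ∀ V : Submodule k (Fin N → k), p ∈ V → (∀ x ∈ V, eval x f = 0) →
      V ≤ LinearMap.ker D := by
    intro V hpV hV z hz
    rw [LinearMap.mem_ker, hD, (linp_zero_iff p z hf).mpr]
    · simp
    · intro x hx
      apply hV
      exact (Submodule.span_le.mpr (by
        rintro y (rfl | rfl)
        · exact hpV
        · exact hz)) hx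
  have hTD : T ≤ LinearMap.ker D := by
    rw [hT]
    refine sup_le (sup_le (hsub _ hpm.1 h1) (hsub _ hpm.2 h2)) ?_
    rw [Submodule.span_singleton_le_iff_mem, LinearMap.mem_ker, hD, h3]
  obtain ⟨i0, hi0⟩ := Function.ne_iff.mp hp
  let q : MvPolynomial (Fin N) k := C (p i0)⁻¹ * X i0
  let y : Fin N → MvPolynomial (Fin N) k := fun i => X i - q * C (p i)
  have hy : ∀ i, y i ∈ vanIdeal k N ↑(V₁ ⊓ V₂) := by
    intro i x hx
    rw [hP] at hx
    obtain ⟨c, rfl⟩ := Submodule.mem_span_singleton.mp hx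
    simp only [y, q, map_sub, map_mul, eval_X, eval_C, Pi.smul_apply, smul_eq_mul]
    simp only [Pi.zero_apply] at hi0
    field_simp
    ring
  have ht := taylor_mem (vanIdeal k N ↑(V₁ ⊓ V₂)) (fun i => q * C (p i)) y hy f
  have hc : ∀ g : MvPolynomial (Fin N) k,
      aeval (fun i => (C (p i) : MvPolynomial (Fin N) k)) g = C (eval p g) := by
    intro g
    have := MvPolynomial.aeval_algebraMap_apply (MvPolynomial (Fin N) k) p g
    rw [MvPolynomial.aeval_eq_eval] at this
    exact this
  have e1 : (fun i => q * C (p i) + y i) = (X : Fin N → MvPolynomial (Fin N) k) := by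
    funext i
    simp [y]
  rw [e1, aeval_smul_homog q _ hf, hc, h1 p hpm.1, aeval_X_left] at ht
  simp only [map_zero, mul_zero, sub_zero, AlgHom.id_apply] at ht
  rw [show f = (f - ∑ i, aeval (fun i => q * C (p i)) (pderiv i f) * y i)
    + ∑ i, aeval (fun i => q * C (p i)) (pderiv i f) * y i by ring]
  apply Submodule.add_mem_sup ht
  intro x hx
  have hz : D (x - (eval x q) • p) = 0 := by
    rw [map_sub, map_smul, LinearMap.mem_ker.mp (hTD hx),
      LinearMap.mem_ker.mp (hsub _ hpm.1 h1 hpm.1)]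
    simp
  have hD' : ∀ z, D z = ∑ i, eval p (pderiv i f) * z i := by
    intro z
    simp [D]
  rw [hD'] at hz
  rw [map_sum]
  calc ∑ i, eval x (aeval (fun i => q * C (p i)) (pderiv i f) * y i)
      = eval x q ^ (d - 1) * ∑ i, eval p (pderiv i f) * (x - (eval x q) • p) i := by
        rw [Finset.mul_sum]
        refine Finset.sum_congr rfl fun i _ => ?_
        rw [aeval_smul_homog q _ hf.pderiv, hc]
        simp [y]
        ring
    _ = 0 := by rw [hz, mul_zero]

end helpers2

section helpers3

variable {k : Type} [Field k]

theorem exists_span_pair {N : ℕ} (V : Submodule k (Fin N → k)) (hV : Module.finrank k V = 2)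
    (p : Fin N → k) (hp : p ≠ 0) (hpV : p ∈ V) :
    ∃ u, u ≠ 0 ∧ V = Submodule.span k {p, u} := by
  have h1 : Submodule.span k {p} ≤ V := (Submodule.span_singleton_le_iff_mem _ _).mpr hpV
  have h2 : ∃ u ∈ V, u ∉ Submodule.span k {p} := by
    by_contra! hcon
    have := Submodule.finrank_mono (show V ≤ Submodule.span k {p} from hcon)
    rw [finrank_span_singleton hp] at this
    omega
  obtain ⟨u, huV, hu⟩ := h2
  refine ⟨u, ?_, ?_⟩
  · rintro rfl
    exact hu (Submodule.zero_mem _)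
  · symm
    apply Submodule.eq_of_le_of_finrank_le
    · rw [Submodule.span_le]
      rintro x (rfl | rfl)
      · exact hpV
      · exact huV
    · rw [hV]
      have hlt : Submodule.span k {p} < Submodule.span k {p, u} := by
        refine lt_of_le_of_ne (Submodule.span_mono (by simp)) ?_
        intro he
        exact hu (he ▸ Submodule.subset_span (by simp))
      have := Submodule.finrank_lt_finrank_of_lt hlt
      rw [finrank_span_singleton hp] at this
      omega

theorem sundial_data {N : ℕ} {V₁ V₂ T : Submodule k (Fin N → k)} (h : IsSundial k N V₁ V₂ T) :
    ∃ p u v w : Fin N → k, p ≠ 0 ∧ V₁ ⊓ V₂ = Submodule.span k {p} ∧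
      V₁ = Submodule.span k {p, u} ∧ V₂ = Submodule.span k {p, v} ∧
      T = V₁ ⊔ V₂ ⊔ Submodule.span k {w} ∧
      ∀ s : k, s ≠ 0 → Module.finrank k (Submodule.span k {p + s • w, v}) = 2 := by
  obtain ⟨h1, h2, hne, h3, hle, h4⟩ := h
  obtain ⟨⟨p, hpm⟩, hp0, hp⟩ := finrank_eq_one_iff'.mp h3
  have hp0' : p ≠ 0 := fun hh => hp0 (Subtype.ext hh)
  have hP : V₁ ⊓ V₂ = Submodule.span k {p} := by
    apply le_antisymm
    · intro x hx
      obtain ⟨c, hc⟩ := hp ⟨x, hx⟩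
      exact Submodule.mem_span_singleton.mpr ⟨c, congrArg Subtype.val hc⟩
    · exact (Submodule.span_singleton_le_iff_mem _ _).mpr hpm
  obtain ⟨u, hu0, hu⟩ := exists_span_pair V₁ h1 p hp0' hpm.1
  obtain ⟨v, hv0, hv⟩ := exists_span_pair V₂ h2 p hp0' hpm.2
  have hsum := Submodule.finrank_sup_add_finrank_inf_eq V₁ V₂
  obtain ⟨w, hwT, hw⟩ : ∃ w ∈ T, w ∉ V₁ ⊔ V₂ := by
    by_contra! hcon
    have := Submodule.finrank_mono (show T ≤ V₁ ⊔ V₂ from hcon)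
    omega
  refine ⟨p, u, v, w, hp0', hP, hu, hv, ?_, ?_⟩
  · symm
    apply Submodule.eq_of_le_of_finrank_le
    · exact sup_le hle ((Submodule.span_singleton_le_iff_mem _ _).mpr hwT)
    · have hlt : V₁ ⊔ V₂ < V₁ ⊔ V₂ ⊔ Submodule.span k {w} := by
        refine lt_of_le_of_ne le_sup_left ?_
        intro he
        apply hw
        rw [he]
        exact Submodule.mem_sup_right (Submodule.mem_span_singleton_self w)
      have := Submodule.finrank_lt_finrank_of_lt hlt
      omega
  · intro s hs
    have hvV : v ∈ V₂ := by
      rw [hv]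
      exact Submodule.subset_span (by simp)
    have hli : LinearIndependent k ![p + s • w, v] := by
      rw [LinearIndependent.pair_iff]
      intro a b hab
      have ha : a = 0 := by
        by_contra ha
        apply hw
        apply Submodule.mem_sup_right
        have : (a * s) • w ∈ V₂ := by
          have e : (a * s) • w = -(a • p) - b • v := by
            rw [eq_sub_iff_add_eq, eq_neg_iff_add_eq_zero, ← hab, smul_add, smul_smul]
            abel
          rw [e]
          exact V₂.sub_mem (V₂.neg_mem (V₂.smul_mem _ hpm.2)) (V₂.smul_mem _ hvV)
        exact (V₂.smul_mem_iff (mul_ne_zero ha hs)).mp this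
      refine ⟨ha, ?_⟩
      rw [ha, zero_smul, zero_add] at hab
      exact (smul_eq_zero.mp hab).resolve_right hv0
    have := finrank_span_eq_card hli
    have e : Set.range ![p + s • w, v] = {p + s • w, v} := by
      simp only [Matrix.range_cons, Matrix.range_empty, Set.union_empty]
      rfl
    rw [e] at this
    simpa using this

noncomputable abbrev pc {N : ℕ} (d : ℕ) (I : Ideal (MvPolynomial (Fin N) k)) :
    Submodule k (MvPolynomial (Fin N) k) :=
  Submodule.restrictScalars k
        (I : Submodule (MvPolynomial (Fin N) k) (MvPolynomial (Fin N) k))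
      ⊓ MvPolynomial.homogeneousSubmodule (Fin N) k d

instance pc_fin {N : ℕ} (d : ℕ) (I : Ideal (MvPolynomial (Fin N) k)) :
    Module.Finite k (pc d I) := by
  have := homog_finite (k := k) N d
  exact Submodule.finiteDimensional_of_le (inf_le_right : pc d I ≤ homogeneousSubmodule (Fin N) k d)

/-- imposing `I` costs at most `m` conditions -/
def Bd {N : ℕ} (d : ℕ) (I : Ideal (MvPolynomial (Fin N) k)) (m : ℕ) : Prop :=
  ∀ K, hdim k N K d ≤ hdim k N (K ⊓ I) d + m

theorem Bd.inf {N d m m' : ℕ} {I J : Ideal (MvPolynomial (Fin N) k)} (hI : Bd d I m)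
    (hJ : Bd d J m') : Bd d (I ⊓ J) (m + m') := by
  intro K
  have h1 := hI K
  have h2 := hJ (K ⊓ I)
  rw [inf_assoc] at h2
  omega

theorem Bd.top {N d : ℕ} : Bd d (⊤ : Ideal (MvPolynomial (Fin N) k)) 0 := by
  intro K
  simp

theorem iInf_fin_succ' {α : Type*} [CompleteLattice α] {a : ℕ} (f : Fin (a+1) → α) :
    (⨅ i, f i) = f 0 ⊓ ⨅ i : Fin a, f i.succ := by
  apply le_antisymm
  · exact le_inf (iInf_le _ _) (le_iInf fun i => iInf_le _ _)
  · apply le_iInf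
    intro i
    refine Fin.cases ?_ (fun i => ?_) i
    · exact inf_le_left
    · exact inf_le_of_right_le (iInf_le _ _)

theorem Bd.iInf {N d m : ℕ} : ∀ {a : ℕ} (f : Fin a → Ideal (MvPolynomial (Fin N) k))
    (_ : ∀ i, Bd d (f i) m), Bd d (⨅ i, f i) (a * m) := by
  intro a
  induction a with
  | zero =>
    intro f _
    rw [iInf_of_empty, zero_mul]
    exact Bd.top
  | succ a ih =>
    intro f hf
    rw [iInf_fin_succ', show (a + 1) * m = m + a * m by ring]
    exact (hf 0).inf (ih _ fun i => hf i.succ)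

theorem hdim_le_of_functionals {N d : ℕ} {ι : Type} [Fintype ι]
    (K I : Ideal (MvPolynomial (Fin N) k)) (φ : MvPolynomial (Fin N) k →ₗ[k] (ι → k))
    (h : ∀ f ∈ K, f.IsHomogeneous d → φ f = 0 → f ∈ I) :
    hdim k N K d ≤ hdim k N I d + Fintype.card ι := by
  apply finrank_le_of_functionals (pc d K) (pc d I) φ
  intro f hf h0
  exact ⟨h f hf.1 hf.2 h0, hf.2⟩

theorem hdim_mono {N d : ℕ} {I J : Ideal (MvPolynomial (Fin N) k)} (h : I ≤ J) :
    hdim k N I d ≤ hdim k N J d := by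
  apply Submodule.finrank_mono (s := pc d I) (t := pc d J)
  intro f hf
  exact ⟨h hf.1, hf.2⟩

noncomputable def linCoeffs {N : ℕ} (d : ℕ) (p u : Fin N → k) :
    MvPolynomial (Fin N) k →ₗ[k] (Fin (d+1) → k) where
  toFun f := fun j => (linp p u f).coeff j
  map_add' f g := by
    ext i
    simp
  map_smul' c f := by
    ext i
    simp

theorem Bd.line [Infinite k] {N d : ℕ} {V : Submodule k (Fin N → k)}
    (hV : Module.finrank k V = 2) : Bd d (vanIdeal k N ↑V) (d + 1) := by
  intro K
  obtain ⟨p, hpV, hp⟩ : ∃ p ∈ V, p ≠ 0 := by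
    apply Submodule.exists_mem_ne_zero_of_ne_bot
    rintro rfl
    simp at hV
  obtain ⟨u, -, hu⟩ := exists_span_pair V hV p hp hpV
  have := hdim_le_of_functionals (d := d) K (K ⊓ vanIdeal k N ↑V) (linCoeffs d p u) (by
    intro f hfK hf h0
    refine ⟨hfK, ?_⟩
    have hz : linp p u f = 0 := linp_eq_zero_of_coeff p u hf
      (fun j hj => congrFun h0 ⟨j, by omega⟩)
    rw [hu]
    exact (linp_zero_iff p u hf).mp hz)
  simpa using this

theorem Bd.point {N d : ℕ} (x : Fin N → k) :
    Bd d (vanIdeal k N ↑(Submodule.span k {x})) 1 := by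
  intro K
  have := hdim_le_of_functionals (d := d) K (K ⊓ vanIdeal k N ↑(Submodule.span k {x}))
    (LinearMap.pi (fun _ : Unit => (MvPolynomial.aeval x).toLinearMap)) (by
    intro f hfK hf h0
    refine ⟨hfK, ?_⟩
    intro y hy
    obtain ⟨c, rfl⟩ := Submodule.mem_span_singleton.mp hy
    have h1 := congrFun h0 ()
    simp [MvPolynomial.aeval_eq_eval] at h1
    rw [eval_smul_homog c x hf, h1, mul_zero])
  simpa using this

theorem Bd.conic [Infinite k] {N d : ℕ} {V₁ V₂ T : Submodule k (Fin N → k)}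
    (h : IsSundial k N V₁ V₂ T) : Bd d (vanIdeal k N ↑V₁ ⊓ vanIdeal k N ↑V₂) (2 * d + 1) := by
  intro K
  obtain ⟨p, u, v, w, hp0, hP, hu, hv, hT, hs⟩ := sundial_data h
  have := hdim_le_of_functionals (d := d) K (K ⊓ (vanIdeal k N ↑V₁ ⊓ vanIdeal k N ↑V₂))
    (psi d p u v) (by
    intro f hfK hf h0
    have := psi_zero p u v hf h0
    rw [← hu, ← hv] at this
    exact ⟨hfK, this.1, this.2⟩)
  simp only [Fintype.card_sum, Fintype.card_fin] at this
  omega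

theorem conic_le_sundial [Infinite k] {N d : ℕ} {V₁ V₂ T : Submodule k (Fin N → k)}
    (h : IsSundial k N V₁ V₂ T) (K : Ideal (MvPolynomial (Fin N) k)) :
    hdim k N (K ⊓ (vanIdeal k N ↑V₁ ⊓ vanIdeal k N ↑V₂)) d
      ≤ hdim k N (K ⊓ sundialIdeal k N V₁ V₂ T) d + 1 := by
  obtain ⟨p, u, v, w, hp0, hP, hu, hv, hT, hs⟩ := sundial_data h
  have := hdim_le_of_functionals (d := d) (K ⊓ (vanIdeal k N ↑V₁ ⊓ vanIdeal k N ↑V₂))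
    (K ⊓ sundialIdeal k N V₁ V₂ T)
    (LinearMap.pi (fun _ : Unit => Polynomial.lcoeff k 1 ∘ₗ (linp p w).toLinearMap)) (by
    intro f hfK hf h0
    refine ⟨hfK.1, mem_sundial V₁ V₂ T p w hp0 hP hT hf hfK.2.1 hfK.2.2 ?_⟩
    exact congrFun h0 ())
  simpa using this

theorem Bd.sundial [Infinite k] {N d : ℕ} {V₁ V₂ T : Submodule k (Fin N → k)}
    (h : IsSundial k N V₁ V₂ T) : Bd d (sundialIdeal k N V₁ V₂ T) (2 * (d + 1)) := by
  intro K
  have h1 := Bd.conic (d := d) h K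
  have h2 := conic_le_sundial (d := d) h K
  omega

theorem sundial_to_lines [Infinite k] {N d : ℕ} {V₁ V₂ T : Submodule k (Fin N → k)}
    (h : IsSundial k N V₁ V₂ T) (K : Ideal (MvPolynomial (Fin N) k))
    (hK : hdim k N (K ⊓ sundialIdeal k N V₁ V₂ T) d + 2 * (d + 1) ≤ hdim k N K d) :
    ∃ M₁ M₂ : Submodule k (Fin N → k), Module.finrank k M₁ = 2 ∧ Module.finrank k M₂ = 2 ∧
      hdim k N (K ⊓ (vanIdeal k N ↑M₁ ⊓ vanIdeal k N ↑M₂)) d + 2 * (d + 1) ≤ hdim k N K d := by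
  obtain ⟨p, u, v, w, hp0, hP, hu, hv, hT, hs⟩ := sundial_data h
  have hcard : Fintype.card ((Fin (d+1) ⊕ Fin d) ⊕ Unit) = 2 * (d + 1) := by
    simp only [Fintype.card_sum, Fintype.card_fin, Fintype.card_unit]
    omega
  obtain ⟨s, hs0, hsem⟩ := semicont (pc d K) (pc d (K ⊓ sundialIdeal k N V₁ V₂ T))
    (phi d p u v w) (phiQ d p u v w) (fun s f i => phiQ_eval d p u v w s f i)
    (by
      intro f hf h0
      have := phi_zero p u v w hf.2 h0
      rw [← hu, ← hv] at this
      exact ⟨⟨hf.1, mem_sundial V₁ V₂ T p w hp0 hP hT hf.2 this.1 this.2.1 this.2.2⟩, hf.2⟩)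
    (by rw [hcard]; exact hK)
  refine ⟨V₁, Submodule.span k {p + s • w, v}, h.1, hs s hs0, ?_⟩
  rw [← hcard]
  apply hsem (pc d _)
  · intro f hf
    exact ⟨hf.1.1, hf.2⟩
  · intro f hf
    apply phi_of_vanish p u v w s hs0 hf.2
    · rw [← hu]
      exact hf.1.2.1
    · exact hf.1.2.2

theorem sundial_to_conic [Infinite k] {N d : ℕ} (hd : 1 ≤ d) {V₁ V₂ T : Submodule k (Fin N → k)}
    (h : IsSundial k N V₁ V₂ T) (K : Ideal (MvPolynomial (Fin N) k))
    (hK : hdim k N (K ⊓ sundialIdeal k N V₁ V₂ T) d + 2 * (d + 1) ≤ hdim k N K d) :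
    ∃ R : Submodule k (Fin N → k), Module.finrank k R = 1 ∧
      hdim k N (K ⊓ (vanIdeal k N ↑V₁ ⊓ vanIdeal k N ↑V₂ ⊓ vanIdeal k N ↑R)) d + 2 * (d + 1)
        ≤ hdim k N K d := by
  have h1 := Bd.conic (d := d) h K
  have h2 := conic_le_sundial (d := d) h K
  set D := vanIdeal k N ↑V₁ ⊓ vanIdeal k N ↑V₂ with hD
  have hpos : 0 < hdim k N (K ⊓ D) d := by omega
  have hex : ∃ f ∈ pc d (K ⊓ D), f ≠ 0 := by
    apply Submodule.exists_mem_ne_zero_of_ne_bot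
    intro hb
    have : hdim k N (K ⊓ D) d = Module.finrank k (pc d (K ⊓ D)) := rfl
    rw [hb] at this
    simp at this
    omega
  obtain ⟨f, hf, hf0⟩ := hex
  have hx : ∃ x, eval x f ≠ 0 := by
    by_contra! hcon
    exact hf0 (MvPolynomial.funext fun x => by simpa using hcon x)
  obtain ⟨x, hx⟩ := hx
  have hx0 : x ≠ 0 := by
    rintro rfl
    have := eval_smul_homog (0 : k) (0 : Fin N → k) hf.2
    rw [zero_smul, zero_pow (by omega), zero_mul] at this
    exact hx this
  refine ⟨Submodule.span k {x}, finrank_span_singleton hx0, ?_⟩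
  have hlt : hdim k N (K ⊓ (D ⊓ vanIdeal k N ↑(Submodule.span k {x}))) d
      < hdim k N (K ⊓ D) d := by
    change Module.finrank k (pc d (K ⊓ (D ⊓ vanIdeal k N ↑(Submodule.span k {x}))))
      < Module.finrank k (pc d (K ⊓ D))
    apply Submodule.finrank_lt_finrank_of_lt
    refine lt_of_le_of_ne ?_ ?_
    · intro g hg
      exact ⟨⟨hg.1.1, hg.1.2.1⟩, hg.2⟩
    · intro he
      have : f ∈ pc d (K ⊓ (D ⊓ vanIdeal k N ↑(Submodule.span k {x}))) := he ▸ hf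
      exact hx (this.1.2.2 x (Submodule.mem_span_singleton_self x))
  omega

end helpers3

section helpers4

variable {k : Type} [Field k]

/-- Configurations with `a` sundials, `b` conics with points, `c` lines imposing the expected
number of conditions. -/
def EE (k : Type) [Field k] (N d a b c : ℕ) : Prop :=
  ∃ (f : Fin a → Ideal (MvPolynomial (Fin N) k)) (g : Fin b → Ideal (MvPolynomial (Fin N) k))
    (h : Fin c → Ideal (MvPolynomial (Fin N) k)),
    (∀ i, ∃ V₁ V₂ T, IsSundial k N V₁ V₂ T ∧ f i = sundialIdeal k N V₁ V₂ T) ∧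
    (∀ i, ∃ (V₁ V₂ T R : Submodule k (Fin N → k)), IsSundial k N V₁ V₂ T ∧ Module.finrank k R = 1 ∧
      g i = vanIdeal k N ↑V₁ ⊓ vanIdeal k N ↑V₂ ⊓
        vanIdeal k N ↑R) ∧
    (∀ i, ∃ M : Submodule k (Fin N → k), Module.finrank k M = 2 ∧ h i = vanIdeal k N ↑M) ∧
    hdim k N ((⨅ i, f i) ⊓ (⨅ i, g i) ⊓ ⨅ i, h i) d + (2 * a + 2 * b + c) * (d + 1)
      ≤ hdim k N ⊤ d

theorem Bd_conf [Infinite k] {N d a b c : ℕ} {f : Fin a → Ideal (MvPolynomial (Fin N) k)}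
    {g : Fin b → Ideal (MvPolynomial (Fin N) k)} {h : Fin c → Ideal (MvPolynomial (Fin N) k)}
    (hf : ∀ i, ∃ V₁ V₂ T, IsSundial k N V₁ V₂ T ∧ f i = sundialIdeal k N V₁ V₂ T)
    (hg : ∀ i, ∃ (V₁ V₂ T R : Submodule k (Fin N → k)), IsSundial k N V₁ V₂ T ∧ Module.finrank k R = 1 ∧
      g i = vanIdeal k N ↑V₁ ⊓ vanIdeal k N ↑V₂ ⊓
        vanIdeal k N ↑R)
    (hh : ∀ i, ∃ M : Submodule k (Fin N → k), Module.finrank k M = 2 ∧ h i = vanIdeal k N ↑M) :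
    Bd d ((⨅ i, f i) ⊓ (⨅ i, g i) ⊓ ⨅ i, h i) ((2 * a + 2 * b + c) * (d + 1)) := by
  have h1 : Bd d (⨅ i, f i) (a * (2 * (d + 1))) := by
    apply Bd.iInf
    intro i
    obtain ⟨V₁, V₂, T, hS, e⟩ := hf i
    rw [e]
    exact Bd.sundial hS
  have h2 : Bd d (⨅ i, g i) (b * (2 * (d + 1))) := by
    apply Bd.iInf
    intro i
    obtain ⟨V₁, V₂, T, R, hS, hR, e⟩ := hg i
    obtain ⟨⟨p, hpm⟩, hp0, hp⟩ := finrank_eq_one_iff'.mp hR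
    have hP : R = Submodule.span k {p} := by
      apply le_antisymm
      · intro x hx
        obtain ⟨c, hc⟩ := hp ⟨x, hx⟩
        exact Submodule.mem_span_singleton.mpr ⟨c, congrArg Subtype.val hc⟩
      · exact (Submodule.span_singleton_le_iff_mem _ _).mpr hpm
    rw [e, hP, show 2 * (d + 1) = 2 * d + 1 + 1 by ring]
    exact (Bd.conic hS).inf (Bd.point p)
  have h3 : Bd d (⨅ i, h i) (c * (d + 1)) := by
    apply Bd.iInf
    intro i
    obtain ⟨M, hM, e⟩ := hh i
    rw [e]
    exact Bd.line hM
  have := (h1.inf h2).inf h3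
  convert! this using 1
  ring

theorem EE_bound [Infinite k] {N d a b c : ℕ} {f : Fin a → Ideal (MvPolynomial (Fin N) k)}
    {g : Fin b → Ideal (MvPolynomial (Fin N) k)} {h : Fin c → Ideal (MvPolynomial (Fin N) k)}
    (hf : ∀ i, ∃ V₁ V₂ T, IsSundial k N V₁ V₂ T ∧ f i = sundialIdeal k N V₁ V₂ T)
    (hg : ∀ i, ∃ (V₁ V₂ T R : Submodule k (Fin N → k)), IsSundial k N V₁ V₂ T ∧ Module.finrank k R = 1 ∧
      g i = vanIdeal k N ↑V₁ ⊓ vanIdeal k N ↑V₂ ⊓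
        vanIdeal k N ↑R)
    (hh : ∀ i, ∃ M : Submodule k (Fin N → k), Module.finrank k M = 2 ∧ h i = vanIdeal k N ↑M) :
    hdim k N ⊤ d ≤
      hdim k N ((⨅ i, f i) ⊓ (⨅ i, g i) ⊓ ⨅ i, h i) d + (2 * a + 2 * b + c) * (d + 1) := by
  have := Bd_conf (d := d) hf hg hh ⊤
  rwa [top_inf_eq] at this

theorem EE_drop [Infinite k] {N d a b c : ℕ} (hE : EE k N d a b (c + 1)) : EE k N d a b c := by
  obtain ⟨f, g, h, hf, hg, hh, hle⟩ := hE
  refine ⟨f, g, fun i => h i.succ, hf, hg, fun i => hh i.succ, ?_⟩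
  obtain ⟨M, hM, e⟩ := hh 0
  have h1 := Bd.line (d := d) hM ((⨅ i, f i) ⊓ (⨅ i, g i) ⊓ ⨅ i : Fin c, h i.succ)
  rw [iInf_fin_succ' h, e] at hle
  rw [show (⨅ i, f i) ⊓ (⨅ i, g i) ⊓ (vanIdeal k N ↑M ⊓ ⨅ i : Fin c, h i.succ)
    = (⨅ i, f i) ⊓ (⨅ i, g i) ⊓ (⨅ i : Fin c, h i.succ) ⊓ vanIdeal k N ↑M by ac_rfl] at hle
  have : (2 * a + 2 * b + (c + 1)) * (d + 1) = (2 * a + 2 * b + c) * (d + 1) + (d + 1) := by ring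
  beta_reduce
  omega

theorem EE_lines [Infinite k] {N d a b c : ℕ} (hE : EE k N d (a + 1) b c) :
    EE k N d a b (c + 2) := by
  obtain ⟨f, g, h, hf, hg, hh, hle⟩ := hE
  obtain ⟨V₁, V₂, T, hS, e⟩ := hf 0
  have hK := EE_bound (d := d) (fun i : Fin a => hf i.succ) hg hh
  rw [iInf_fin_succ' f, e, show sundialIdeal k N V₁ V₂ T ⊓ (⨅ i : Fin a, f i.succ) ⊓ (⨅ i, g i)
    ⊓ (⨅ i, h i) = (⨅ i : Fin a, f i.succ) ⊓ (⨅ i, g i) ⊓ (⨅ i, h i)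
      ⊓ sundialIdeal k N V₁ V₂ T by ac_rfl] at hle
  have h2 := Bd.sundial (d := d) hS ((⨅ i : Fin a, f i.succ) ⊓ (⨅ i, g i) ⊓ (⨅ i, h i))
  have e1 : (2 * (a + 1) + 2 * b + c) * (d + 1)
    = (2 * a + 2 * b + c) * (d + 1) + 2 * (d + 1) := by ring
  obtain ⟨M₁, M₂, hM₁, hM₂, h3⟩ := sundial_to_lines (d := d) hS
    ((⨅ i : Fin a, f i.succ) ⊓ (⨅ i, g i) ⊓ (⨅ i, h i)) (by omega)
  refine ⟨fun i => f i.succ, g, Fin.cons (vanIdeal k N ↑M₁) (Fin.cons (vanIdeal k N ↑M₂) h),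
    fun i => hf i.succ, hg, ?_, ?_⟩
  · intro i
    refine Fin.cases ⟨M₁, hM₁, rfl⟩ (fun i => ?_) i
    refine Fin.cases ⟨M₂, hM₂, rfl⟩ (fun i => ?_) i
    exact hh i
  · rw [iInf_fin_succ' (Fin.cons _ _)]
    simp only [Fin.cons_zero, Fin.cons_succ]
    rw [iInf_fin_succ' (Fin.cons _ _)]
    simp only [Fin.cons_zero, Fin.cons_succ]
    rw [show (⨅ i : Fin a, f i.succ) ⊓ (⨅ i, g i)
      ⊓ (vanIdeal k N ↑M₁ ⊓ (vanIdeal k N ↑M₂ ⊓ (⨅ i, h i)))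
      = (⨅ i : Fin a, f i.succ) ⊓ (⨅ i, g i) ⊓ (⨅ i, h i)
        ⊓ (vanIdeal k N ↑M₁ ⊓ vanIdeal k N ↑M₂) by ac_rfl]
    have e2 : (2 * a + 2 * b + (c + 2)) * (d + 1)
      = (2 * a + 2 * b + c) * (d + 1) + 2 * (d + 1) := by ring
    beta_reduce
    omega

theorem EE_conic [Infinite k] {N d a b c : ℕ} (hd : 1 ≤ d) (hE : EE k N d (a + 1) b c) :
    EE k N d a (b + 1) c := by
  obtain ⟨f, g, h, hf, hg, hh, hle⟩ := hE
  obtain ⟨V₁, V₂, T, hS, e⟩ := hf 0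
  have hK := EE_bound (d := d) (fun i : Fin a => hf i.succ) hg hh
  rw [iInf_fin_succ' f, e, show sundialIdeal k N V₁ V₂ T ⊓ (⨅ i : Fin a, f i.succ) ⊓ (⨅ i, g i)
    ⊓ (⨅ i, h i) = (⨅ i : Fin a, f i.succ) ⊓ (⨅ i, g i) ⊓ (⨅ i, h i)
      ⊓ sundialIdeal k N V₁ V₂ T by ac_rfl] at hle
  have h2 := Bd.sundial (d := d) hS ((⨅ i : Fin a, f i.succ) ⊓ (⨅ i, g i) ⊓ (⨅ i, h i))
  have e1 : (2 * (a + 1) + 2 * b + c) * (d + 1)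
    = (2 * a + 2 * b + c) * (d + 1) + 2 * (d + 1) := by ring
  obtain ⟨R, hR, h3⟩ := sundial_to_conic hd hS
    ((⨅ i : Fin a, f i.succ) ⊓ (⨅ i, g i) ⊓ (⨅ i, h i)) (by omega)
  refine ⟨fun i => f i.succ,
    Fin.cons (vanIdeal k N ↑V₁ ⊓ vanIdeal k N ↑V₂ ⊓ vanIdeal k N ↑R) g, h,
    fun i => hf i.succ, ?_, hh, ?_⟩
  · intro i
    refine Fin.cases ⟨V₁, V₂, T, R, hS, hR, rfl⟩ (fun i => ?_) i
    exact hg i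
  · rw [iInf_fin_succ' (Fin.cons _ _)]
    simp only [Fin.cons_zero, Fin.cons_succ]
    rw [show (⨅ i : Fin a, f i.succ)
      ⊓ ((vanIdeal k N ↑V₁ ⊓ vanIdeal k N ↑V₂ ⊓ vanIdeal k N ↑R) ⊓ (⨅ i, g i)) ⊓ (⨅ i, h i)
      = (⨅ i : Fin a, f i.succ) ⊓ (⨅ i, g i) ⊓ (⨅ i, h i)
        ⊓ (vanIdeal k N ↑V₁ ⊓ vanIdeal k N ↑V₂ ⊓ vanIdeal k N ↑R) by ac_rfl]
    have e2 : (2 * a + 2 * (b + 1) + c) * (d + 1)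
      = (2 * a + 2 * b + c) * (d + 1) + 2 * (d + 1) := by ring
    beta_reduce
    omega

theorem two_mul_le_t (n d t : ℕ) (hn : 3 ≤ n) (hd : 1 ≤ d) (ht : t = (d+n).choose n / (d+1)) :
    2 * (d - 1) ≤ t := by
  rw [ht, Nat.le_div_iff_mul_le (by omega)]
  have h1 : (d + 3).choose 3 ≤ (d + n).choose n := by
    rw [← Nat.choose_symm_add (a := d) (b := 3), ← Nat.choose_symm_add (a := d) (b := n)]
    exact Nat.choose_le_choose d (by omega)
  refine le_trans ?_ h1
  have h2 : (d + 3).choose 3 * 6 = (d + 3) * (d + 2) * (d + 1) := by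
    have := Nat.descFactorial_eq_factorial_mul_choose (d + 3) 3
    simp [Nat.descFactorial, Nat.factorial] at this
    linarith
  obtain ⟨e, rfl⟩ : ∃ e, d = e + 1 := ⟨d - 1, by omega⟩
  simp only [Nat.add_sub_cancel]
  zify at h2 ⊢
  nlinarith [mul_nonneg (show (0:ℤ) ≤ (e:ℤ) + 2 by positivity)
    (show (0:ℤ) ≤ (e:ℤ)^2 - 5 * e + 12 by nlinarith [sq_nonneg (2 * (e:ℤ) - 5)])]

end helpers4

/-- Lemma 4.5(i) of the paper: if statement `S(n,d)` holds (generic sundials and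
lines impose the expected number of conditions in degree `d`), then so does
`S(n,d;a,b,c)` (generic sundials, degenerate conics, points and lines). -/
theorem stmt11 (k : Type) [Field k] [IsAlgClosed k] [CharZero k]
    (n d a b c t : ℕ) (hn : 3 ≤ n) (hd : 1 ≤ d)
    (hab : a + b ≤ d - 1) (ht : t = (d+n).choose n / (d+1))
    (hc : c + 2*(a+b) ≤ t)
    (hS : ∃ (V₁ V₂ T : Fin (d-1) → Submodule k (Fin (n+1) → k))
        (M : Fin (t - 2*(d-1)) → Submodule k (Fin (n+1) → k)),
        (∀ i, IsSundial k (n+1) (V₁ i) (V₂ i) (T i)) ∧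
        (∀ j, Module.finrank k (M j) = 2) ∧
        (hdim k (n+1) ((⨅ i, sundialIdeal k (n+1) (V₁ i) (V₂ i) (T i)) ⊓
            ⨅ j, vanIdeal k (n+1) ↑(M j)) d : ℤ)
          = ((d+n).choose n : ℤ) - t * (d+1)) :
    ∃ (V₁ V₂ T : Fin a → Submodule k (Fin (n+1) → k))
      (D₁ D₂ : Fin b → Submodule k (Fin (n+1) → k))
      (R : Fin b → Submodule k (Fin (n+1) → k))
      (M : Fin c → Submodule k (Fin (n+1) → k)),
      (∀ i, IsSundial k (n+1) (V₁ i) (V₂ i) (T i)) ∧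
      (∀ j, Module.finrank k (D₁ j) = 2 ∧ Module.finrank k (D₂ j) = 2 ∧
        D₁ j ≠ D₂ j ∧ Module.finrank k ↥(D₁ j ⊓ D₂ j) = 1) ∧
      (∀ j, Module.finrank k (R j) = 1) ∧
      (∀ l, Module.finrank k (M l) = 2) ∧
      (hdim k (n+1) ((⨅ i, sundialIdeal k (n+1) (V₁ i) (V₂ i) (T i)) ⊓
          (⨅ j, vanIdeal k (n+1) ↑(D₁ j) ⊓ vanIdeal k (n+1) ↑(D₂ j)) ⊓
          (⨅ j, vanIdeal k (n+1) ↑(R j)) ⊓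
          ⨅ l, vanIdeal k (n+1) ↑(M l)) d : ℤ)
        = ((d+n).choose n : ℤ) - (2*a + 2*b + c) * (d+1) := by
  have hinf : Infinite k := CharZero.infinite k
  have hNtop : hdim k (n+1) ⊤ d = (d+n).choose n := by
    rw [← finrank_homog (k := k) n d]
    unfold hdim
    rw [Submodule.restrictScalars_top, top_inf_eq]
  have htt : 2 * (d - 1) ≤ t := two_mul_le_t n d t hn hd ht
  have htN : t * (d + 1) ≤ (d+n).choose n := by
    rw [ht]
    exact Nat.div_mul_le_self _ _
  have hE0 : EE k (n+1) d (a + b + (d - 1 - a - b)) 0 (t - 2 * (d - 1)) := by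
    have he : a + b + (d - 1 - a - b) = d - 1 := by omega
    rw [he]
    obtain ⟨V₁, V₂, T, M, h1, h2, h3⟩ := hS
    refine ⟨fun i => sundialIdeal k (n+1) (V₁ i) (V₂ i) (T i), Fin.elim0,
      fun j => vanIdeal k (n+1) ↑(M j), fun i => ⟨_, _, _, h1 i, rfl⟩, fun i => i.elim0,
      fun j => ⟨_, h2 j, rfl⟩, ?_⟩
    rw [iInf_of_empty (ι := Fin 0), inf_top_eq, hNtop]
    have : 2 * (d - 1) + 2 * 0 + (t - 2 * (d - 1)) = t := by omega
    rw [this]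
    zify
    rw [h3]
    linarith
  have hE1 : ∀ r a' c', EE k (n+1) d (a' + r) 0 c' → EE k (n+1) d a' 0 (c' + 2 * r) := by
    intro r
    induction r with
    | zero => intro a' c' h; exact h
    | succ r ih =>
      intro a' c' h
      have := ih a' (c' + 2) (EE_lines h)
      rwa [show c' + 2 * (r + 1) = c' + 2 + 2 * r by ring]
  have hE2 : ∀ b' b'' c', EE k (n+1) d (a + b') b'' c' → EE k (n+1) d a (b'' + b') c' := by
    intro b'
    induction b' with
    | zero => intro b'' c' h; exact h
    | succ r ih =>
      intro b'' c' h
      have := ih (b'' + 1) c' (EE_conic hd h)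
      rwa [show b'' + (r + 1) = b'' + 1 + r by ring]
  have hE3 : ∀ r c', EE k (n+1) d a b (c' + r) → EE k (n+1) d a b c' := by
    intro r
    induction r with
    | zero => intro c' h; exact h
    | succ r ih => intro c' h; exact ih c' (EE_drop h)
  have h4 := hE2 b 0 _ (hE1 _ _ _ hE0)
  rw [zero_add] at h4
  obtain ⟨r, hr⟩ : ∃ r, t - 2 * (d - 1) + 2 * (d - 1 - a - b) = c + r :=
    ⟨t - 2 * (d - 1) + 2 * (d - 1 - a - b) - c, by omega⟩
  rw [hr] at h4
  obtain ⟨f, g, h, hf, hg, hh, hle⟩ := hE3 r c h4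
  have hge := EE_bound (d := d) hf hg hh
  choose V₁ V₂ T hS1 hf' using hf
  choose D₁ D₂ T' R hS2 hR hg' using hg
  choose M hM hh' using hh
  refine ⟨V₁, V₂, T, D₁, D₂, R, M, hS1, fun j => ⟨(hS2 j).1, (hS2 j).2.1, (hS2 j).2.2.1,
    (hS2 j).2.2.2.1⟩, hR, hM, ?_⟩
  have hfe : f = fun i => sundialIdeal k (n+1) (V₁ i) (V₂ i) (T i) := funext hf'
  have hge' : g = fun j => vanIdeal k (n+1) ↑(D₁ j) ⊓ vanIdeal k (n+1) ↑(D₂ j) ⊓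
    vanIdeal k (n+1) ↑(R j) := funext hg'
  have hhe : h = fun l => vanIdeal k (n+1) ↑(M l) := funext hh'
  rw [hfe, hge', hhe, hNtop, iInf_inf_eq, ← inf_assoc] at hle hge
  have heq := le_antisymm hle hge
  zify at heq
  rw [← heq]
  ring
end
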